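/- Let N ≥ 3, α > 0, k = k(α) = (2N-2+α)/(2+α), and let F : ℝ → ℝ be continuously differentiable. Suppose V_α ∈ C²((0,∞)) is a positive solution of -V'' - (k/t)V' = F(V) on (0,∞) with lim_{t→0⁺} V_α'(t) = 0 and lim_{t→∞} V_α(t) = 0, that V_α has Morse index one, that V_α' ∈ E, and that V_α is nondegenerate. Let u_α(x) = V_α((2/(2+α))|x|^{(2+α)/2}). Then the linearized problem -Δw = |x|^α F'(u_α)·w on ℝ^N∖{0}, with |x|^{α/2}w ∈ L²(ℝ^N) and |∇w| ∈ L²(ℝ^N), admits a nontrivial solution w if and only if α = 2i for some positive integer i; and in that case the real vector space of all such solutions has dimension (N+2i)·(N+i-2)! / ((N-2)!·(i+1)!). -/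

import Mathlib

open MeasureTheory Filter Set Topology

/-- The Euclidean Laplacian: sum of second partial derivatives. -/
noncomputable def lap {N : ℕ} (u : EuclideanSpace ℝ (Fin N) → ℝ)
    (x : EuclideanSpace ℝ (Fin N)) : ℝ :=
  ∑ i : Fin N, fderiv ℝ (fun y => fderiv ℝ u y (EuclideanSpace.single i 1)) x
    (EuclideanSpace.single i 1)

/-- k(α) = (2N-2+α)/(2+α). -/
noncomputable def kk (N : ℕ) (α : ℝ) : ℝ := (2 * (N : ℝ) - 2 + α) / (2 + α)

/-- Membership in the space `E`: a `C¹` function on `(0,∞)` with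
`∫₀^∞ t^k ((w')² + w²) dt < ∞`. -/
def memE (k : ℝ) (w : ℝ → ℝ) : Prop :=
  ContDiffOn ℝ 1 w (Ioi 0) ∧
  IntegrableOn (fun t => t ^ k * ((deriv w t) ^ 2 + (w t) ^ 2)) (Ioi 0)

/-- The Rayleigh quotient
`R(w) = (∫₀^∞ t^k ((w')² − A·w²) dt) / (∫₀^∞ t^k w² dt)`. -/
noncomputable def Ray (k : ℝ) (A : ℝ → ℝ) (w : ℝ → ℝ) : ℝ :=
  (∫ t in Ioi (0:ℝ), t ^ k * ((deriv w t) ^ 2 - A t * (w t) ^ 2)) /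
    ∫ t in Ioi (0:ℝ), t ^ k * (w t) ^ 2

/-- Morse index one: the infimum of the Rayleigh quotient over nonzero elements of `E`
is negative, while on every two-dimensional subspace of `E` the maximum of the
Rayleigh quotient over nonzero elements is nonnegative. -/
def MorseIndexOne (k : ℝ) (A : ℝ → ℝ) : Prop :=
  (∃ w, memE k w ∧ (∃ t ∈ Ioi (0:ℝ), w t ≠ 0) ∧ Ray k A w < 0) ∧
  ∀ w₁ w₂ : ℝ → ℝ, memE k w₁ → memE k w₂ →
    (∀ c₁ c₂ : ℝ, (∀ t ∈ Ioi (0:ℝ), c₁ * w₁ t + c₂ * w₂ t = 0) → c₁ = 0 ∧ c₂ = 0) →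
    ∃ c₁ c₂ : ℝ, ¬(c₁ = 0 ∧ c₂ = 0) ∧
      0 ≤ Ray k A (fun t => c₁ * w₁ t + c₂ * w₂ t)

/-- Nondegeneracy: the linearized ODE `-w'' - (k/t) w' = A w` has no nontrivial
solution in `E`. -/
def RadNondeg (k : ℝ) (A : ℝ → ℝ) : Prop :=
  ∀ w : ℝ → ℝ, ContDiffOn ℝ 2 w (Ioi 0) → memE k w →
    (∀ t > (0:ℝ), -(deriv (deriv w) t) - k / t * deriv w t = A t * w t) →
    ∀ t > (0:ℝ), w t = 0

/-- A solution in `E` of the linearized ODE `-ψ'' - (k/t) ψ' = A ψ` on `(0,∞)`. -/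
def LinODESol (k : ℝ) (A : ℝ → ℝ) (ψ : ℝ → ℝ) : Prop :=
  ContDiffOn ℝ 2 ψ (Ioi 0) ∧ memE k ψ ∧
  ∀ t > (0:ℝ), -(deriv (deriv ψ) t) - k / t * deriv ψ t = A t * ψ t

/-- A solution of the linearized problem `-Δw = |x|^α a w` on `ℝ^N∖{0}` with
`|x|^{α/2} w ∈ L²(ℝ^N)` and `|∇w| ∈ L²(ℝ^N)`. -/
def LinSolution (N : ℕ) (α : ℝ) (a : EuclideanSpace ℝ (Fin N) → ℝ)
    (w : EuclideanSpace ℝ (Fin N) → ℝ) : Prop :=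
  ContDiffOn ℝ 2 w {x | x ≠ 0} ∧
  (∀ x : EuclideanSpace ℝ (Fin N), x ≠ 0 → -(lap w x) = ‖x‖ ^ α * a x * w x) ∧
  Integrable (fun x : EuclideanSpace ℝ (Fin N) => ‖x‖ ^ α * (w x) ^ 2) ∧
  Integrable (fun x : EuclideanSpace ℝ (Fin N) => ‖fderiv ℝ w x‖ ^ 2)

/-- `(N+2i)·(N+i-2)! / ((N-2)!·(i+1)!)`. -/
def dimN (N i : ℕ) : ℕ :=
  (N + 2 * i) * Nat.factorial (N + i - 2) / (Nat.factorial (N - 2) * Nat.factorial (i + 1))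

/-- The integral over `(0,∞)` of a derivative `G'` vanishes when `G'` and `G t / t` are
integrable. -/
lemma integral_Ioi_deriv_eq_zero {G G' : ℝ → ℝ} (hG : ∀ t > (0:ℝ), HasDerivAt G (G' t) t)
    (hG' : IntegrableOn G' (Ioi 0)) (hGt : IntegrableOn (fun t => G t / t) (Ioi 0)) :
    ∫ t in Ioi (0:ℝ), G' t = 0 := by
  have himg : Real.exp '' univ = Ioi 0 := by simp [Real.range_exp]
  have hd : ∀ x ∈ (univ : Set ℝ), HasDerivWithinAt Real.exp (Real.exp x) univ x :=
    fun x _ => (Real.hasDerivAt_exp x).hasDerivWithinAt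
  have hinj : InjOn Real.exp univ := Real.exp_injective.injOn
  have h1 := integral_image_eq_integral_abs_deriv_smul MeasurableSet.univ hd hinj G'
  have h2 := (integrableOn_image_iff_integrableOn_abs_deriv_smul MeasurableSet.univ hd hinj G').1
    (by rwa [himg])
  have h3 := (integrableOn_image_iff_integrableOn_abs_deriv_smul MeasurableSet.univ hd hinj
    (fun t => G t / t)).1 (by rwa [himg])
  rw [himg] at h1
  rw [h1, setIntegral_univ]
  rw [integrableOn_univ] at h2 h3
  refine integral_eq_zero_of_hasDerivAt_of_integrable (f := fun s => G (Real.exp s)) ?_ h2 ?_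
  · intro s
    have := (hG _ (Real.exp_pos s)).comp s (Real.hasDerivAt_exp s)
    simpa [Function.comp_def, abs_of_pos (Real.exp_pos s), mul_comm] using this
  · refine h3.congr (ae_of_all _ fun s => ?_)
    have := (Real.exp_pos s).ne'
    simp only [abs_of_pos (Real.exp_pos s), smul_eq_mul]
    field_simp

lemma continuousOn_rpow_Ioi (p : ℝ) : ContinuousOn (fun t : ℝ => t ^ p) (Ioi 0) :=
  fun t ht => (Real.continuousAt_rpow_const t p (Or.inl (ne_of_gt ht))).continuousWithinAt

/-- Comparison test on `(0,∞)` for continuous functions. -/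
lemma ContinuousOn.integrableOn_Ioi_of_le {f g : ℝ → ℝ} (hf : ContinuousOn f (Ioi 0))
    (hg : IntegrableOn g (Ioi 0)) (hfg : ∀ t > 0, |f t| ≤ g t) : IntegrableOn f (Ioi 0) := by
  refine Integrable.mono' hg (hf.aestronglyMeasurable measurableSet_Ioi) ?_
  filter_upwards [ae_restrict_mem measurableSet_Ioi] with t ht
  exact hfg t ht

lemma integrableOn_weight_mul {p : ℝ} {f g : ℝ → ℝ} (hf : ContinuousOn f (Ioi 0))
    (hg : ContinuousOn g (Ioi 0)) (hf2 : IntegrableOn (fun t => t ^ p * f t ^ 2) (Ioi 0))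
    (hg2 : IntegrableOn (fun t => t ^ p * g t ^ 2) (Ioi 0)) :
    IntegrableOn (fun t => t ^ p * (f t * g t)) (Ioi 0) := by
  refine ContinuousOn.integrableOn_Ioi_of_le ((continuousOn_rpow_Ioi p).mul (hf.mul hg))
    (hf2.add hg2) fun t ht => ?_
  have ht' : 0 ≤ t ^ p := Real.rpow_nonneg (le_of_lt ht) p
  rw [abs_mul, abs_of_nonneg ht', Pi.add_apply, ← mul_add]
  refine mul_le_mul_of_nonneg_left ?_ ht'
  rw [abs_le]
  constructor <;> nlinarith [sq_nonneg (f t + g t), sq_nonneg (f t - g t)]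

section memE

variable {k : ℝ} {w : ℝ → ℝ}

lemma memE.continuousOn (h : memE k w) : ContinuousOn w (Ioi 0) := h.1.continuousOn

lemma memE.continuousOn_deriv (h : memE k w) : ContinuousOn (deriv w) (Ioi 0) :=
  h.1.continuousOn_deriv_of_isOpen isOpen_Ioi le_rfl

lemma memE.hasDerivAt (h : memE k w) {t : ℝ} (ht : 0 < t) : HasDerivAt w (deriv w t) t :=
  ((h.1.differentiableOn (by norm_num)).differentiableAt (Ioi_mem_nhds ht)).hasDerivAt

lemma memE.integrableOn_sq (h : memE k w) : IntegrableOn (fun t => t ^ k * w t ^ 2) (Ioi 0) := by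
  refine ContinuousOn.integrableOn_Ioi_of_le
    ((continuousOn_rpow_Ioi k).mul (h.continuousOn.pow 2)) h.2 fun t ht => ?_
  have ht' : 0 ≤ t ^ k := Real.rpow_nonneg (le_of_lt ht) k
  rw [abs_of_nonneg (by positivity)]
  exact mul_le_mul_of_nonneg_left (by nlinarith [sq_nonneg (deriv w t)]) ht'

lemma memE.integrableOn_deriv_sq (h : memE k w) :
    IntegrableOn (fun t => t ^ k * deriv w t ^ 2) (Ioi 0) := by
  refine ContinuousOn.integrableOn_Ioi_of_le
    ((continuousOn_rpow_Ioi k).mul (h.continuousOn_deriv.pow 2)) h.2 fun t ht => ?_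
  have ht' : 0 ≤ t ^ k := Real.rpow_nonneg (le_of_lt ht) k
  rw [abs_of_nonneg (by positivity)]
  exact mul_le_mul_of_nonneg_left (by nlinarith [sq_nonneg (w t)]) ht'

/-- Hardy's inequality in qualitative form. -/
lemma memE.integrableOn_hardy (hk : 1 < k) (h : memE k w) :
    IntegrableOn (fun t => t ^ (k - 2) * w t ^ 2) (Ioi 0) := by
  have hcont : ContinuousOn (fun t => t ^ (k - 2) * w t ^ 2) (Ioi 0) :=
    (continuousOn_rpow_Ioi _).mul (h.continuousOn.pow 2)
  rw [← Ioc_union_Ioi_eq_Ioi (zero_le_one' ℝ), integrableOn_union]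
  constructor
  · set c := (k - 1) / 2 with hc
    have hcpos : 0 < c := by rw [hc]; linarith
    set D := ∫ t in Ioi (0:ℝ), t ^ k * deriv w t ^ 2
    refine integrableOn_Ioc_of_intervalIntegral_norm_bounded_left (ι := ℕ) (l := atTop)
      (a := fun n => 1 / ((n:ℝ) + 1)) (I := (w 1 ^ 2 + D / c) / c) ?_
      tendsto_one_div_add_atTop_nhds_zero_nat ?_
    · intro n
      have : (0:ℝ) < 1 / ((n:ℝ) + 1) := by positivity
      exact (ContinuousOn.integrableOn_Icc (hcont.mono fun x hx => this.trans_le hx.1)).mono_set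
        Ioc_subset_Icc_self
    · refine Eventually.of_forall fun n => ?_
      set a := 1 / ((n:ℝ) + 1) with ha
      have ha0 : 0 < a := by positivity
      have ha1 : a ≤ 1 := by
        rw [ha, div_le_one (by positivity)]
        linarith [(Nat.cast_nonneg n : (0:ℝ) ≤ n)]
      have hsub : Icc a 1 ⊆ Ioi 0 := fun x hx => ha0.trans_le hx.1
      have hcont' : ContinuousOn (fun t => (k - 1) * t ^ (k - 2) * w t ^ 2 +
          2 * t ^ (k - 1) * (w t * deriv w t)) (Ioi 0) :=
        ((continuousOn_const.mul (continuousOn_rpow_Ioi _)).mul (h.continuousOn.pow 2)).add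
          ((continuousOn_const.mul (continuousOn_rpow_Ioi _)).mul
            (h.continuousOn.mul h.continuousOn_deriv))
      have hFTC : ∫ t in a..1, ((k - 1) * t ^ (k - 2) * w t ^ 2 +
          2 * t ^ (k - 1) * (w t * deriv w t)) = 1 ^ (k - 1) * w 1 ^ 2 - a ^ (k - 1) * w a ^ 2 := by
        refine intervalIntegral.integral_eq_sub_of_hasDerivAt
          (f := fun t => t ^ (k - 1) * w t ^ 2) ?_ ?_
        · intro t ht
          rw [uIcc_of_le ha1] at ht
          have ht0 : 0 < t := hsub ht
          have h1 := (Real.hasDerivAt_rpow_const (x := t) (p := k - 1) (Or.inl ht0.ne')).mul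
            ((h.hasDerivAt ht0).pow 2)
          refine HasDerivAt.congr_deriv (f := fun t => t ^ (k - 1) * w t ^ 2) h1 ?_
          rw [show k - 1 - 1 = k - 2 by ring]
          simp only [Pi.pow_apply]
          norm_num
          ring
        · rw [intervalIntegrable_iff_integrableOn_Icc_of_le ha1]
          exact (hcont'.mono hsub).integrableOn_Icc
      have hint1 : IntegrableOn (fun t => t ^ (k - 2) * w t ^ 2) (Ioc a 1) :=
        ((hcont.mono hsub).integrableOn_Icc).mono_set Ioc_subset_Icc_self
      have hint2 : IntegrableOn (fun t => t ^ k * deriv w t ^ 2) (Ioc a 1) :=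
        h.integrableOn_deriv_sq.mono_set fun x hx => ha0.trans hx.1
      have hint3 : IntegrableOn (fun t => (k - 1) * t ^ (k - 2) * w t ^ 2 +
          2 * t ^ (k - 1) * (w t * deriv w t)) (Ioc a 1) :=
        ((hcont'.mono hsub).integrableOn_Icc).mono_set Ioc_subset_Icc_self
      rw [intervalIntegral.integral_of_le ha1] at hFTC
      have hle : ∫ t in Ioc a 1, (c * (t ^ (k - 2) * w t ^ 2) - (t ^ k * deriv w t ^ 2) / c) ≤
          ∫ t in Ioc a 1, ((k - 1) * t ^ (k - 2) * w t ^ 2 +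
          2 * t ^ (k - 1) * (w t * deriv w t)) := by
        refine setIntegral_mono_on ((hint1.const_mul c).sub (hint2.div_const c)) hint3
          measurableSet_Ioc fun t ht => ?_
        have ht0 : 0 < t := ha0.trans ht.1
        have e1 : t ^ (k - 1) = t ^ (k - 2) * t := by
          rw [← Real.rpow_add_one ht0.ne']; congr 1; ring
        have e2 : t ^ k = t ^ (k - 2) * t ^ 2 := by
          rw [← Real.rpow_natCast, ← Real.rpow_add ht0]; congr 1; push_cast; ring
        have hk1 : k - 1 = 2 * c := by rw [hc]; ring
        rw [e2, show t ^ (k - 1) = t ^ (k - 2) * t from e1, hk1]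
        have hp : 0 ≤ t ^ (k - 2) * (c * (w t + t * deriv w t / c) ^ 2) := by positivity
        have : t ^ (k - 2) * (c * (w t + t * deriv w t / c) ^ 2) =
          c * (t ^ (k - 2) * w t ^ 2) + 2 * (t ^ (k - 2) * t) * (w t * deriv w t) +
            t ^ (k - 2) * t ^ 2 * deriv w t ^ 2 / c := by
          field_simp
          ring
        linarith
      rw [hFTC, integral_sub (hint1.const_mul c) (hint2.div_const c), integral_const_mul,
        integral_div] at hle
      have hD : ∫ t in Ioc a 1, t ^ k * deriv w t ^ 2 ≤ D := by
        refine setIntegral_mono_set h.integrableOn_deriv_sq ?_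
          (LE.le.eventuallyLE fun x hx => ha0.trans hx.1)
        filter_upwards [ae_restrict_mem measurableSet_Ioi] with t ht
        exact mul_nonneg (Real.rpow_nonneg (le_of_lt ht) _) (sq_nonneg _)
      have hnorm : ∫ t in Ioc a 1, ‖t ^ (k - 2) * w t ^ 2‖ =
          ∫ t in Ioc a 1, t ^ (k - 2) * w t ^ 2 := by
        refine setIntegral_congr_fun measurableSet_Ioc fun t ht => ?_
        have : 0 ≤ t ^ (k - 2) := Real.rpow_nonneg (ha0.trans ht.1).le _
        exact Real.norm_of_nonneg (by positivity)
      rw [hnorm, le_div_iff₀ hcpos]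
      have h5 : (∫ t in Ioc a 1, t ^ k * deriv w t ^ 2) / c ≤ D / c :=
        div_le_div_of_nonneg_right hD hcpos.le
      have h6 : 0 ≤ a ^ (k - 1) * w a ^ 2 :=
        mul_nonneg (Real.rpow_nonneg ha0.le _) (sq_nonneg _)
      rw [Real.one_rpow] at hle
      linarith
  · refine Integrable.mono' (h.integrableOn_sq.mono_set (Ioi_subset_Ioi zero_le_one))
      ((hcont.mono (Ioi_subset_Ioi zero_le_one)).aestronglyMeasurable measurableSet_Ioi) ?_
    filter_upwards [ae_restrict_mem measurableSet_Ioi] with t ht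
    have ht0 : (0:ℝ) < t := zero_lt_one.trans ht
    rw [Real.norm_of_nonneg (mul_nonneg (Real.rpow_nonneg ht0.le _) (sq_nonneg _))]
    exact mul_le_mul_of_nonneg_right
      (Real.rpow_le_rpow_of_exponent_le (le_of_lt ht) (by linarith)) (sq_nonneg _)

end memE

/-- A solution in `E` of the singular linearized equation
`-ψ'' - (k/t) ψ' + (μ/t²) ψ = A ψ` on `(0,∞)`. -/
def SingSol (k : ℝ) (A : ℝ → ℝ) (μ : ℝ) (ψ : ℝ → ℝ) : Prop :=
  ContDiffOn ℝ 2 ψ (Ioi 0) ∧ memE k ψ ∧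
  ∀ t > (0:ℝ), -(deriv (deriv ψ) t) - k / t * deriv ψ t + μ / t ^ 2 * ψ t = A t * ψ t

lemma integral_weight_mul_self_pos {p : ℝ} {f : ℝ → ℝ} (hf : ContinuousOn f (Ioi 0))
    (hint : IntegrableOn (fun t => t ^ p * (f t * f t)) (Ioi 0)) {s : ℝ} (hs : 0 < s)
    (hfs : f s ≠ 0) : 0 < ∫ t in Ioi (0:ℝ), t ^ p * (f t * f t) := by
  have hnn : 0 ≤ᵐ[volume.restrict (Ioi 0)] fun t => t ^ p * (f t * f t) := by
    filter_upwards [ae_restrict_mem measurableSet_Ioi] with t ht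
    exact mul_nonneg (Real.rpow_nonneg (le_of_lt ht) _) (mul_self_nonneg _)
  rw [setIntegral_pos_iff_support_of_nonneg_ae hnn hint]
  have hcont : ContinuousOn (fun t => t ^ p * (f t * f t)) (Ioi 0) :=
    (continuousOn_rpow_Ioi p).mul (hf.mul hf)
  have hopen : IsOpen (Ioi 0 ∩ (fun t => t ^ p * (f t * f t)) ⁻¹' {0}ᶜ) :=
    hcont.isOpen_inter_preimage isOpen_Ioi isOpen_compl_singleton
  have heq : (Function.support fun t => t ^ p * (f t * f t)) ∩ Ioi 0 =
      Ioi 0 ∩ (fun t => t ^ p * (f t * f t)) ⁻¹' {0}ᶜ := by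
    ext t
    simp [Function.mem_support, and_comm]
  rw [heq]
  refine hopen.measure_pos volume ⟨s, hs, ?_⟩
  simp [(Real.rpow_pos_of_pos hs p).ne', hfs]

section Form

variable {k M : ℝ} {A : ℝ → ℝ}

lemma memE.integrableOn_hardy_mul {f g : ℝ → ℝ} (hk : 1 < k) (hf : memE k f) (hg : memE k g) :
    IntegrableOn (fun t => t ^ (k - 2) * (f t * g t)) (Ioi 0) :=
  integrableOn_weight_mul hf.continuousOn hg.continuousOn (hf.integrableOn_hardy hk)
    (hg.integrableOn_hardy hk)

lemma memE.integrableOn_form (hA : ContinuousOn A (Ioi 0)) (hM : ∀ t > 0, |A t| ≤ M)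
    {f g : ℝ → ℝ} (hf : memE k f) (hg : memE k g) :
    IntegrableOn (fun t => t ^ k * (deriv f t * deriv g t - A t * (f t * g t))) (Ioi 0) := by
  have h1 := integrableOn_weight_mul hf.continuousOn_deriv hg.continuousOn_deriv
    hf.integrableOn_deriv_sq hg.integrableOn_deriv_sq
  have h2 := integrableOn_weight_mul hf.continuousOn hg.continuousOn
    hf.integrableOn_sq hg.integrableOn_sq
  have h3 : IntegrableOn (fun t => A t * (t ^ k * (f t * g t))) (Ioi 0) := by
    refine ContinuousOn.integrableOn_Ioi_of_le (hA.mul ((continuousOn_rpow_Ioi k).mul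
      (hf.continuousOn.mul hg.continuousOn))) (h2.norm.const_mul M) fun t ht => ?_
    rw [abs_mul, Real.norm_eq_abs]
    exact mul_le_mul_of_nonneg_right (hM t ht) (abs_nonneg _)
  refine (h1.sub h3).congr (ae_of_all _ fun t => ?_)
  simp only [Pi.sub_apply]
  ring

lemma SingSol.hasDerivAt_deriv {μ : ℝ} {ψ : ℝ → ℝ} (h : SingSol k A μ ψ) {t : ℝ} (ht : 0 < t) :
    HasDerivAt (deriv ψ) (deriv (deriv ψ) t) t := by
  have h2 : ContDiffOn ℝ 1 (deriv ψ) (Ioi 0) :=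
    ((contDiffOn_succ_iff_deriv_of_isOpen (n := 1) isOpen_Ioi).1 (by rw [one_add_one_eq_two]; exact h.1)).2.2
  exact ((h2.differentiableOn (by norm_num)).differentiableAt (Ioi_mem_nhds ht)).hasDerivAt

/-- Testing the singular linearized equation against an element of `E`. -/
lemma SingSol.integral_form_eq {μ : ℝ} {ψ φ : ℝ → ℝ} (hk : 1 < k) (hA : ContinuousOn A (Ioi 0))
    (hM : ∀ t > 0, |A t| ≤ M) (hψ : SingSol k A μ ψ) (hφ : memE k φ) :
    ∫ t in Ioi (0:ℝ), t ^ k * (deriv ψ t * deriv φ t - A t * (ψ t * φ t)) =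
      -(μ * ∫ t in Ioi (0:ℝ), t ^ (k - 2) * (ψ t * φ t)) := by
  have h1 := hψ.2.1.integrableOn_form hA hM hφ
  have h2 := (hψ.2.1.integrableOn_hardy_mul hk hφ).const_mul μ
  have h0 : ∫ t in Ioi (0:ℝ), (t ^ k * (deriv ψ t * deriv φ t - A t * (ψ t * φ t)) +
      μ * (t ^ (k - 2) * (ψ t * φ t))) = 0 := by
    refine integral_Ioi_deriv_eq_zero (G := fun t => t ^ k * deriv ψ t * φ t) ?_ (h1.add h2) ?_
    · intro t ht
      have hd := ((Real.hasDerivAt_rpow_const (x := t) (p := k) (Or.inl ht.ne')).mul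
        (hψ.hasDerivAt_deriv ht)).mul (hφ.hasDerivAt ht)
      refine HasDerivAt.congr_deriv (f := fun t => t ^ k * deriv ψ t * φ t) hd ?_
      have hE := hψ.2.2 t ht
      have e1 : t ^ (k - 1) = t ^ (k - 2) * t := by
        rw [← Real.rpow_add_one ht.ne']; congr 1; ring
      have e2 : t ^ k = t ^ (k - 2) * t ^ 2 := by
        rw [← Real.rpow_natCast, ← Real.rpow_add ht]; congr 1; push_cast; ring
      have hE' : deriv (deriv ψ) t = -(k / t * deriv ψ t) + μ / t ^ 2 * ψ t - A t * ψ t := by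
        linarith
      simp only [Pi.mul_apply]
      rw [hE', e1, e2]
      have := ht.ne'
      field_simp
      ring
    · have h3 := integrableOn_weight_mul (p := k) (f := deriv ψ) (g := fun t => φ t / t)
        hψ.2.1.continuousOn_deriv
        (hφ.continuousOn.div continuousOn_id fun t ht => ne_of_gt ht)
        hψ.2.1.integrableOn_deriv_sq ?_
      · refine h3.congr (ae_of_all _ fun t => ?_)
        simp only
        ring
      · refine (hφ.integrableOn_hardy hk).congr ?_
        filter_upwards [ae_restrict_mem measurableSet_Ioi] with t ht
        have ht : 0 < t := ht
        have e2 : t ^ k = t ^ (k - 2) * t ^ 2 := by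
          rw [← Real.rpow_natCast, ← Real.rpow_add ht]; congr 1; push_cast; ring
        rw [e2]
        field_simp
  rw [integral_add h1 h2, integral_const_mul] at h0
  linarith

lemma deriv_lin_comb {f g : ℝ → ℝ} (hf : memE k f) (hg : memE k g) (a b : ℝ) {t : ℝ}
    (ht : 0 < t) :
    deriv (fun t => a * f t + b * g t) t = a * deriv f t + b * deriv g t :=
  (((hf.hasDerivAt ht).const_mul a).add ((hg.hasDerivAt ht).const_mul b)).deriv

lemma memE.lin_comb {f g : ℝ → ℝ} (hf : memE k f) (hg : memE k g) (a b : ℝ) :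
    memE k (fun t => a * f t + b * g t) := by
  refine ⟨(contDiffOn_const.mul hf.1).add (contDiffOn_const.mul hg.1), ?_⟩
  have hf1 := hf.integrableOn_deriv_sq
  have hg1 := hg.integrableOn_deriv_sq
  have h1 := integrableOn_weight_mul hf.continuousOn_deriv hg.continuousOn_deriv hf1 hg1
  have hf2 := hf.integrableOn_sq
  have hg2 := hg.integrableOn_sq
  have h2 := integrableOn_weight_mul hf.continuousOn hg.continuousOn hf2 hg2
  refine ((((hf1.add hf2).const_mul (a ^ 2)).add ((hg1.add hg2).const_mul (b ^ 2))).add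
    ((h1.add h2).const_mul (2 * a * b))).congr ?_
  filter_upwards [ae_restrict_mem measurableSet_Ioi] with t ht
  rw [deriv_lin_comb hf hg a b ht]
  simp only [Pi.add_apply]
  ring

/-- Under the Morse index one condition, solutions of the singular linearized equations with
positive singular parameters are proportional, and vanish if the parameters differ. -/
lemma MorseIndexOne.proportional (hk : 1 < k) (hA : ContinuousOn A (Ioi 0))
    (hM : ∀ t > 0, |A t| ≤ M) (hmorse : MorseIndexOne k A) {μ ν : ℝ} {ψ χ : ℝ → ℝ}
    (hμ : 0 < μ) (hν : 0 < ν) (hψ : SingSol k A μ ψ) (hχ : SingSol k A ν χ)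
    (hχ0 : ∃ t > 0, χ t ≠ 0) :
    ∃ c : ℝ, (∀ t > 0, ψ t = c * χ t) ∧ (μ ≠ ν → c = 0) := by
  set I : (ℝ → ℝ) → (ℝ → ℝ) → ℝ := fun f g => ∫ t in Ioi (0:ℝ), t ^ (k - 2) * (f t * g t) with hI
  have hIcomm : ∀ f g, I f g = I g f := fun f g => by simp only [hI, mul_comm (f _)]
  have hcross : μ ≠ ν → I ψ χ = 0 := by
    intro hne
    have e1 := hψ.integral_form_eq hk hA hM hχ.2.1
    have e2 := hχ.integral_form_eq hk hA hM hψ.2.1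
    have e3 : ∫ t in Ioi (0:ℝ), t ^ k * (deriv ψ t * deriv χ t - A t * (ψ t * χ t)) =
      ∫ t in Ioi (0:ℝ), t ^ k * (deriv χ t * deriv ψ t - A t * (χ t * ψ t)) := by
      simp only [mul_comm (deriv χ _), mul_comm (χ _)]
    rw [e1, e2] at e3
    change -(μ * I ψ χ) = -(ν * I χ ψ) at e3
    rw [hIcomm χ ψ] at e3
    have : (μ - ν) * I ψ χ = 0 := by linarith
    exact (mul_eq_zero.1 this).resolve_left (sub_ne_zero.2 hne)
  have hdep : ∃ a b : ℝ, (∀ t ∈ Ioi (0:ℝ), a * ψ t + b * χ t = 0) ∧ ¬(a = 0 ∧ b = 0) := by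
    by_contra hcon
    push Not at hcon
    obtain ⟨a, b, hab, hR⟩ := hmorse.2 ψ χ hψ.2.1 hχ.2.1
      fun a b h => by_contra fun hn => hn ⟨(hcon a b h).1, (hcon a b h).2⟩
    set W : ℝ → ℝ := fun t => a * ψ t + b * χ t with hW
    have hWE : memE k W := hψ.2.1.lin_comb hχ.2.1 a b
    have hW0 : ∃ t ∈ Ioi (0:ℝ), W t ≠ 0 := by
      by_contra hn
      push Not at hn
      exact hab (hcon a b hn)
    obtain ⟨s, hs, hWs⟩ := hW0
    have hden : 0 < ∫ t in Ioi (0:ℝ), t ^ k * (W t) ^ 2 := by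
      have := integral_weight_mul_self_pos (p := k) hWE.continuousOn
        (by simpa only [sq] using hWE.integrableOn_sq) hs hWs
      simpa only [sq] using this
    have hIW : 0 < I W W := integral_weight_mul_self_pos hWE.continuousOn
      (hWE.integrableOn_hardy_mul hk hWE) hs hWs
    have hnum : ∫ t in Ioi (0:ℝ), t ^ k * ((deriv W t) ^ 2 - A t * (W t) ^ 2) =
        -(a * μ * I ψ W + b * ν * I χ W) := by
      have e1 := hψ.integral_form_eq hk hA hM hWE
      have e2 := hχ.integral_form_eq hk hA hM hWE
      have i1 := hψ.2.1.integrableOn_form hA hM hWE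
      have i2 := hχ.2.1.integrableOn_form hA hM hWE
      have : ∫ t in Ioi (0:ℝ), t ^ k * ((deriv W t) ^ 2 - A t * (W t) ^ 2) =
          ∫ t in Ioi (0:ℝ), (a * (t ^ k * (deriv ψ t * deriv W t - A t * (ψ t * W t))) +
            b * (t ^ k * (deriv χ t * deriv W t - A t * (χ t * W t)))) := by
        refine setIntegral_congr_fun measurableSet_Ioi fun t ht => ?_
        have hd : deriv W t = a * deriv ψ t + b * deriv χ t :=
          deriv_lin_comb hψ.2.1 hχ.2.1 a b ht
        simp only [sq]
        nth_rewrite 1 [hd]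
        nth_rewrite 3 [hW]
        ring
      rw [this, integral_add (i1.const_mul a) (i2.const_mul b), integral_const_mul,
        integral_const_mul, e1, e2]
      simp only [hI]
      ring
    have hexp : ∀ f, memE k f → I f W = a * I f ψ + b * I f χ := by
      intro f hf
      simp only [hI]
      rw [← integral_const_mul, ← integral_const_mul, ← integral_add
        ((hf.integrableOn_hardy_mul hk hψ.2.1).const_mul a)
        ((hf.integrableOn_hardy_mul hk hχ.2.1).const_mul b)]
      refine setIntegral_congr_fun measurableSet_Ioi fun t ht => ?_
      simp only [hW]
      ring
    have hpos : ∀ f, memE k f → 0 ≤ I f f := by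
      intro f hf
      refine setIntegral_nonneg measurableSet_Ioi fun t ht => ?_
      exact mul_nonneg (Real.rpow_nonneg (le_of_lt ht) _) (mul_self_nonneg _)
    have hIW' : I W W = a * I ψ W + b * I χ W := by
      rw [hexp W hWE, hIcomm W ψ, hIcomm W χ]
    have hneg : ∫ t in Ioi (0:ℝ), t ^ k * ((deriv W t) ^ 2 - A t * (W t) ^ 2) < 0 := by
      rw [hnum]
      rw [hIW', hexp ψ hψ.2.1, hexp χ hχ.2.1] at hIW
      rw [hexp ψ hψ.2.1, hexp χ hχ.2.1]
      by_cases hne : μ = ν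
      · subst hne
        nlinarith
      · rw [hIcomm χ ψ, hcross hne] at hIW ⊢
        have p1 := mul_nonneg (sq_nonneg a) (hpos ψ hψ.2.1)
        have p2 := mul_nonneg (sq_nonneg b) (hpos χ hχ.2.1)
        have hm : 0 < min μ ν := lt_min hμ hν
        have m1 := mul_le_mul_of_nonneg_right (min_le_left μ ν) p1
        have m2 := mul_le_mul_of_nonneg_right (min_le_right μ ν) p2
        have m3 := mul_pos hm hIW
        nlinarith
    exact absurd hR (not_le.2 (div_neg_of_neg_of_pos hneg hden))
  obtain ⟨a, b, h0, hab⟩ := hdep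
  obtain ⟨s, hs, hχs⟩ := hχ0
  have ha : a ≠ 0 := by
    rintro rfl
    have := h0 s hs
    simp only [zero_mul, zero_add, mul_eq_zero, hχs, or_false] at this
    exact hab ⟨rfl, this⟩
  have hc : ∀ t > 0, ψ t = -b / a * χ t := by
    intro t ht
    have := h0 t ht
    field_simp
    linarith
  refine ⟨-b / a, hc, fun hne => ?_⟩
  have h1 : I ψ χ = -b / a * I χ χ := by
    simp only [hI]
    rw [← integral_const_mul]
    refine setIntegral_congr_fun measurableSet_Ioi fun t ht => ?_
    simp only [hc t ht]
    ring
  rw [hcross hne] at h1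
  have h2 : 0 < I χ χ := integral_weight_mul_self_pos hχ.2.1.continuousOn
    (hχ.2.1.integrableOn_hardy_mul hk hχ.2.1) hs hχs
  exact (mul_eq_zero.1 h1.symm).resolve_right h2.ne'

end Form

/-- A continuous function on `(0,∞)` with bounded derivative near `0` and a limit at infinity is
bounded. -/
lemma exists_bound_of_tendsto {V : ℝ → ℝ} (hV : DifferentiableOn ℝ V (Ioi 0))
    (hV'0 : Tendsto (deriv V) (𝓝[>] 0) (𝓝 0)) (hVinf : Tendsto V atTop (𝓝 0)) :
    ∃ C, ∀ t > 0, |V t| ≤ C := by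
  have h1 : ∀ᶠ t in 𝓝[>] (0:ℝ), |deriv V t| < 1 := by
    have := hV'0.eventually (Metric.ball_mem_nhds 0 one_pos)
    simpa [Real.dist_eq] using this
  obtain ⟨δ, hδ, hδ1⟩ := mem_nhdsGT_iff_exists_Ioo_subset.1 h1
  have hδ : 0 < δ := hδ
  have h2 : ∀ᶠ t in atTop, |V t| < 1 := by
    have := hVinf.eventually (Metric.ball_mem_nhds 0 one_pos)
    simpa [Real.dist_eq] using this
  obtain ⟨T, hT⟩ := eventually_atTop.1 h2
  have hsub : Icc (δ / 2) T ⊆ Ioi 0 := fun x hx => (half_pos hδ).trans_le hx.1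
  obtain ⟨C, hC⟩ := isCompact_Icc.exists_bound_of_continuousOn (hV.continuousOn.mono hsub)
  refine ⟨max (|V (δ / 2)| + δ / 2) (max C 1), fun t ht => ?_⟩
  rcases le_total t (δ / 2) with h | h
  · refine le_max_of_le_left ?_
    have hd : ∀ x ∈ Icc t (δ / 2), DifferentiableAt ℝ V x := fun x hx =>
      hV.differentiableAt (Ioi_mem_nhds (ht.trans_le hx.1))
    have := (convex_Icc t (δ / 2)).norm_image_sub_le_of_norm_deriv_le (f := V) (C := 1) hd
      (fun x hx => (hδ1 ⟨ht.trans_le hx.1, by linarith [hx.2]⟩ : |deriv V x| < 1).le)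
      (right_mem_Icc.2 h) (left_mem_Icc.2 h)
    rw [Real.norm_eq_abs, Real.norm_eq_abs, abs_of_nonpos (by linarith : t - δ / 2 ≤ 0)] at this
    have h3 := abs_sub_abs_le_abs_sub (V t) (V (δ / 2))
    linarith
  · refine le_max_of_le_right ?_
    rcases le_total t T with h' | h'
    · exact le_max_of_le_left (hC t ⟨h, h'⟩)
    · exact le_max_of_le_right (hT t h').le

/-- The derivative of a solution solves the singular linearized equation with parameter `k`. -/
lemma singSol_deriv {k : ℝ} {F V : ℝ → ℝ} (hF : ContDiff ℝ 1 F) (hV : ContDiffOn ℝ 2 V (Ioi 0))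
    (hode : ∀ t > (0:ℝ), -(deriv (deriv V) t) - k / t * deriv V t = F (V t))
    (hV'E : memE k (deriv V)) : SingSol k (fun t => deriv F (V t)) k (deriv V) := by
  have hVd : DifferentiableOn ℝ V (Ioi 0) := hV.differentiableOn (by norm_num)
  have hEq : EqOn (deriv (deriv V)) (fun t => -F (V t) - k / t * deriv V t) (Ioi 0) := by
    intro t ht
    have := hode t ht
    simp only
    linarith
  have h1 : ContDiffOn ℝ 1 (deriv (deriv V)) (Ioi 0) := by
    refine ContDiffOn.congr ?_ hEq
    refine ((hF.comp_contDiffOn (hV.of_le (by norm_num))).neg).sub (ContDiffOn.mul ?_ hV'E.1)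
    exact contDiffOn_const.div contDiffOn_id fun t ht => ne_of_gt ht
  refine ⟨?_, hV'E, fun t ht => ?_⟩
  · rw [← one_add_one_eq_two, contDiffOn_succ_iff_deriv_of_isOpen isOpen_Ioi]
    exact ⟨hV'E.1.differentiableOn (by norm_num), by simp, h1⟩
  · have hd1 : HasDerivAt (fun s => F (V s)) (deriv F (V t) * deriv V t) t :=
      ((hF.differentiable (by norm_num)) (V t)).hasDerivAt.comp t
        (hVd.differentiableAt (Ioi_mem_nhds ht)).hasDerivAt
    have hd2 : HasDerivAt (fun s => k / s * deriv V s)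
        (-k / t ^ 2 * deriv V t + k / t * deriv (deriv V) t) t := by
      refine HasDerivAt.mul ?_ (hV'E.hasDerivAt ht)
      have := (hasDerivAt_inv ht.ne').const_mul k
      simp only [div_eq_mul_inv]
      exact this.congr_deriv (by ring)
    have hd : deriv (deriv (deriv V)) t =
        -(deriv F (V t) * deriv V t) - (-k / t ^ 2 * deriv V t + k / t * deriv (deriv V) t) := by
      rw [(hEq.eventuallyEq_of_mem (Ioi_mem_nhds ht)).deriv_eq]
      exact (hd1.neg.sub hd2).deriv
    simp only
    rw [hd]
    ring

lemma exists_deriv_ne_zero_of_pos {V : ℝ → ℝ} (hV : DifferentiableOn ℝ V (Ioi 0))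
    (hVpos : ∀ t > (0:ℝ), 0 < V t) (hVinf : Tendsto V atTop (𝓝 0)) :
    ∃ t > 0, deriv V t ≠ 0 := by
  by_contra hcon
  push Not at hcon
  have hconst : ∀ t > 0, V t = V 1 := fun t ht =>
    isOpen_Ioi.is_const_of_deriv_eq_zero (convex_Ioi 0).isPreconnected hV
      (fun x hx => hcon x hx) ht (mem_Ioi.2 one_pos)
  have : Tendsto V atTop (𝓝 (V 1)) :=
    tendsto_const_nhds.congr' ((eventually_gt_atTop 0).mono fun t ht => (hconst t ht).symm)
  exact (hVpos 1 one_pos).ne' (tendsto_nhds_unique this hVinf)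

lemma exists_bound_deriv_comp {F V : ℝ → ℝ} (hF : ContDiff ℝ 1 F) {C : ℝ}
    (hC : ∀ t > 0, |V t| ≤ C) : ∃ M, ∀ t > 0, |deriv F (V t)| ≤ M := by
  obtain ⟨M, hM⟩ := (isCompact_Icc (a := -C) (b := C)).exists_bound_of_continuousOn
    (hF.continuous_deriv le_rfl).continuousOn
  exact ⟨M, fun t ht => hM _ (abs_le.1 (hC t ht))⟩

section Parametric

variable {K : Type*} [TopologicalSpace K]

lemma continuous_slice {G : ℝ → K → ℝ} {U : Set ℝ}
    (hG : ContinuousOn (Function.uncurry G) (U ×ˢ univ)) {s : ℝ} (hs : s ∈ U) :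
    Continuous (G s) :=
  hG.comp_continuous (f := fun θ => (s, θ)) (by fun_prop) fun θ => ⟨hs, mem_univ θ⟩

variable [CompactSpace K]

lemma exists_bound_near {G : ℝ → K → ℝ} {U : Set ℝ} (hU : IsOpen U)
    (hG : ContinuousOn (Function.uncurry G) (U ×ˢ univ)) {s : ℝ} (hs : s ∈ U) :
    ∃ C, ∃ T ∈ 𝓝 s, T ⊆ U ∧ ∀ r ∈ T, ∀ θ, ‖G r θ‖ ≤ C := by
  obtain ⟨T, hT, hTU, hTc⟩ := local_compact_nhds (hU.mem_nhds hs)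
  obtain ⟨C, hC⟩ := (hTc.prod (isCompact_univ (X := K))).exists_bound_of_continuousOn
    (hG.mono (prod_mono hTU le_rfl))
  exact ⟨C, T, hT, hTU, fun r hr θ => hC (r, θ) ⟨hr, mem_univ θ⟩⟩

variable [MeasurableSpace K] [OpensMeasurableSpace K] (μ : Measure K) [IsFiniteMeasure μ]

lemma continuousOn_integral_of_compactSpace {G : ℝ → K → ℝ} {U : Set ℝ} (hU : IsOpen U)
    (hG : ContinuousOn (Function.uncurry G) (U ×ˢ univ)) :
    ContinuousOn (fun s => ∫ θ, G s θ ∂μ) U := by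
  intro s hs
  obtain ⟨C, T, hT, hTU, hC⟩ := exists_bound_near hU hG hs
  refine ContinuousAt.continuousWithinAt (continuousAt_of_dominated (bound := fun _ => C) ?_ ?_
    (integrable_const C) ?_)
  · filter_upwards [hU.mem_nhds hs] with r hr
    exact (continuous_slice hG hr).aestronglyMeasurable
  · filter_upwards [hT] with r hr
    exact ae_of_all _ fun θ => hC r hr θ
  · refine ae_of_all _ fun θ => ?_
    have h1 : ContinuousOn (fun r => G r θ) U :=
      hG.comp (f := fun r => (r, θ)) (by fun_prop) fun r hr => ⟨hr, mem_univ θ⟩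
    exact h1.continuousAt (hU.mem_nhds hs)

lemma hasDerivAt_integral_of_compactSpace {G G' : ℝ → K → ℝ} {U : Set ℝ} (hU : IsOpen U)
    (hG : ContinuousOn (Function.uncurry G) (U ×ˢ univ))
    (hG' : ContinuousOn (Function.uncurry G') (U ×ˢ univ))
    (hd : ∀ s ∈ U, ∀ θ, HasDerivAt (fun r => G r θ) (G' s θ) s) {s : ℝ} (hs : s ∈ U) :
    HasDerivAt (fun r => ∫ θ, G r θ ∂μ) (∫ θ, G' s θ ∂μ) s := by
  obtain ⟨C, T, hT, hTU, hC⟩ := exists_bound_near hU hG' hs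
  obtain ⟨C₁, T₁, hT₁, -, hC₁⟩ := exists_bound_near hU hG hs
  refine (hasDerivAt_integral_of_dominated_loc_of_deriv_le (bound := fun _ => C) hT ?_ ?_ ?_ ?_
    (integrable_const C) ?_).2
  · filter_upwards [hU.mem_nhds hs] with r hr
    exact (continuous_slice hG hr).aestronglyMeasurable
  · exact Integrable.of_bound (continuous_slice hG hs).aestronglyMeasurable C₁
      (ae_of_all _ fun θ => hC₁ s (mem_of_mem_nhds hT₁) θ)
  · exact (continuous_slice hG' hs).aestronglyMeasurable
  · exact ae_of_all _ fun θ r hr => hC r hr θ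
  · exact ae_of_all _ fun θ r hr => hd r (hTU hr) θ

end Parametric

section Rotation

variable {E : Type*} [NormedAddCommGroup E] [InnerProductSpace ℝ E] {f g : E → ℝ}

lemma ContDiffOn.continuousOn_fderiv_ne_zero {F : Type*} [NormedAddCommGroup F] [NormedSpace ℝ F]
    {f : E → F} (hf : ContDiffOn ℝ 1 f {x | x ≠ 0}) :
    ContinuousOn (fderiv ℝ f) {x | x ≠ 0} :=
  hf.continuousOn_fderiv_of_isOpen isOpen_ne le_rfl

lemma ContDiffOn.hasFDerivAt_of_ne_zero {F : Type*} [NormedAddCommGroup F] [NormedSpace ℝ F]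
    {f : E → F} (hf : ContDiffOn ℝ 1 f {x | x ≠ 0}) {x : E} (hx : x ≠ 0) :
    HasFDerivAt f (fderiv ℝ f x) x :=
  ((hf.differentiableOn (by norm_num)).differentiableAt (isOpen_ne.mem_nhds hx)).hasFDerivAt

lemma smul_sphere_ne_zero {r : ℝ} (hr : 0 < r) (θ : Metric.sphere (0:E) 1) :
    r • (θ : E) ≠ 0 :=
  smul_ne_zero hr.ne' (ne_zero_of_mem_unit_sphere θ)

lemma ContDiffOn.continuousOn_skew {J : E →L[ℝ] E} (hf : ContDiffOn ℝ 1 f {x | x ≠ 0}) :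
    ContinuousOn (fun x => fderiv ℝ f x (J x)) {x | x ≠ 0} :=
  hf.continuousOn_fderiv_ne_zero.clm_apply J.continuous.continuousOn

lemma ContDiffOn.skew {J : E →L[ℝ] E} (hf : ContDiffOn ℝ 2 f {x | x ≠ 0}) :
    ContDiffOn ℝ 1 (fun x => fderiv ℝ f x (J x)) {x | x ≠ 0} :=
  (hf.fderiv_of_isOpen isOpen_ne (m := 1) (by norm_num)).clm_apply J.contDiff.contDiffOn

variable [FiniteDimensional ℝ E]

/-- The flow of a skew-adjoint map is by isometries. -/
lemma norm_exp_smul_apply {J : E →L[ℝ] E} (hJ : ∀ x, inner ℝ (J x) x = 0) (s : ℝ) (x : E) :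
    ‖NormedSpace.exp (s • J) x‖ = ‖x‖ := by
  have hd : ∀ s, HasDerivAt (fun s : ℝ => NormedSpace.exp (s • J) x)
      (J (NormedSpace.exp (s • J) x)) s := fun s => by
    have := (hasDerivAt_exp_smul_const' (𝕂 := ℝ) J s).clm_apply (hasDerivAt_const s x)
    simpa using this
  have hn : ∀ s, HasDerivAt (fun s : ℝ => ‖NormedSpace.exp (s • J) x‖ ^ 2) 0 s := fun s => by
    have := (hd s).norm_sq
    rwa [real_inner_comm, hJ, mul_zero] at this
  have hc := is_const_of_deriv_eq_zero (fun s => (hn s).differentiableAt)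
    (fun s => (hn s).deriv) s 0
  simp only [zero_smul, NormedSpace.exp_zero, one_apply_eq_self] at hc
  exact (sq_eq_sq₀ (norm_nonneg _) (norm_nonneg _)).1 hc

variable [MeasurableSpace E] [BorelSpace E]

open scoped Pointwise in
/-- The sphere measure is invariant under linear isometries. -/
lemma integral_toSphere_comp_isometry (L : E ≃ₗᵢ[ℝ] E) (f : E → ℝ) :
    ∫ θ : Metric.sphere (0:E) 1, f (L θ) ∂(volume : Measure E).toSphere =
      ∫ θ : Metric.sphere (0:E) 1, f θ ∂(volume : Measure E).toSphere := by
  have hmem : ∀ θ : Metric.sphere (0:E) 1, L (θ : E) ∈ Metric.sphere (0:E) 1 := fun θ => by simp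
  have hmem' : ∀ θ : Metric.sphere (0:E) 1, L.symm (θ : E) ∈ Metric.sphere (0:E) 1 := fun θ => by simp
  let φ : Metric.sphere (0:E) 1 ≃ₜ Metric.sphere (0:E) 1 :=
    { toFun := fun θ => ⟨L (θ : E), hmem θ⟩
      invFun := fun θ => ⟨L.symm (θ : E), hmem' θ⟩
      left_inv := fun θ => Subtype.ext (L.symm_apply_apply θ)
      right_inv := fun θ => Subtype.ext (L.apply_symm_apply θ)
      continuous_toFun := by fun_prop
      continuous_invFun := by fun_prop }
  have hmp : MeasurePreserving φ (volume : Measure E).toSphere (volume : Measure E).toSphere := by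
    refine ⟨φ.continuous.measurable, Measure.ext fun s hs => ?_⟩
    rw [Measure.map_apply φ.continuous.measurable hs,
      Measure.toSphere_apply' _ (φ.continuous.measurable hs), Measure.toSphere_apply' _ hs]
    congr 1
    have : Ioo (0:ℝ) 1 • (Subtype.val '' (φ ⁻¹' s)) =
        L ⁻¹' (Ioo (0:ℝ) 1 • (Subtype.val '' s)) := by
      ext x
      simp only [Set.mem_smul, mem_image, mem_preimage]
      constructor
      · rintro ⟨a, ha, _, ⟨θ, hθ, rfl⟩, rfl⟩
        exact ⟨a, ha, L θ, ⟨φ θ, hθ, rfl⟩, by simp⟩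
      · rintro ⟨a, ha, _, ⟨θ, hθ, rfl⟩, hx⟩
        refine ⟨a, ha, L.symm θ, ⟨φ.symm θ, by simpa using hθ, rfl⟩, ?_⟩
        rw [← map_smul, hx, L.symm_apply_apply]
    rw [this]
    exact L.measurePreserving.measure_preimage_equiv (f := L.toHomeomorph.toMeasurableEquiv) _
  exact hmp.integral_comp φ.measurableEmbedding fun θ => f θ

/-- The integral over a sphere of the derivative along a rotation field vanishes. -/
lemma integral_toSphere_skew {J : E →L[ℝ] E} (hJ : ∀ x, inner ℝ (J x) x = 0) {f : E → ℝ}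
    (hf : ContDiffOn ℝ 1 f {x | x ≠ 0}) {r : ℝ} (hr : 0 < r) :
    ∫ θ : Metric.sphere (0:E) 1, fderiv ℝ f (r • (θ:E)) (J (r • (θ:E)))
      ∂(volume : Measure E).toSphere = 0 := by
  set R : ℝ → E →L[ℝ] E := fun s => NormedSpace.exp (s • J) with hR
  have hRd : ∀ s, HasDerivAt R (J * R s) s := fun s => hasDerivAt_exp_smul_const' (𝕂 := ℝ) J s
  have hRc : Continuous R := continuous_iff_continuousAt.2 fun s => (hRd s).continuousAt
  have hne : ∀ s, ∀ θ : Metric.sphere (0:E) 1, r • R s θ ≠ 0 := fun s θ => by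
    rw [← norm_ne_zero_iff, norm_smul, hR, norm_exp_smul_apply hJ]
    simp [hr.ne']
  have hjc : Continuous fun p : ℝ × Metric.sphere (0:E) 1 => r • R p.1 (p.2 : E) := by fun_prop
  have h1 : HasDerivAt (fun s => ∫ θ : Metric.sphere (0:E) 1, f (r • R s θ)
      ∂(volume : Measure E).toSphere)
      (∫ θ : Metric.sphere (0:E) 1, fderiv ℝ f (r • R 0 θ) (J (r • R 0 θ))
      ∂(volume : Measure E).toSphere) 0 := by
    refine hasDerivAt_integral_of_compactSpace _ (U := univ) isOpen_univ
      (G := fun s (θ : Metric.sphere (0:E) 1) => f (r • R s θ))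
      (G' := fun s (θ : Metric.sphere (0:E) 1) => fderiv ℝ f (r • R s θ) (J (r • R s θ)))
      ?_ ?_ ?_ (mem_univ 0)
    · exact hf.continuousOn.comp hjc.continuousOn fun p _ => hne p.1 p.2
    · refine ContinuousOn.clm_apply
        (hf.continuousOn_fderiv_ne_zero.comp hjc.continuousOn fun p _ => hne p.1 p.2) ?_
      exact (J.continuous.comp hjc).continuousOn
    · intro s _ θ
      have hx : HasDerivAt (fun s => r • R s (θ:E)) (r • J (R s θ)) s := by
        have := ((hRd s).clm_apply (hasDerivAt_const s (θ:E))).const_smul r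
        simpa [Pi.smul_def] using this
      have := (hf.hasFDerivAt_of_ne_zero (hne s θ)).comp_hasDerivAt s hx
      rwa [← J.map_smul] at this
  have h2 : ∀ s, ∫ θ : Metric.sphere (0:E) 1, f (r • R s θ) ∂(volume : Measure E).toSphere =
      ∫ θ : Metric.sphere (0:E) 1, f (r • (θ:E)) ∂(volume : Measure E).toSphere := fun s => by
    let li : E →ₗᵢ[ℝ] E := ⟨(R s : E →ₗ[ℝ] E), norm_exp_smul_apply hJ s⟩
    exact integral_toSphere_comp_isometry (li.toLinearIsometryEquiv rfl) fun x => f (r • x)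
  simp only [h2] at h1
  have h3 := h1.unique (hasDerivAt_const _ _)
  simpa [hR] using h3

lemma integrable_toSphere {f : E → ℝ} (hf : ContinuousOn f {x | x ≠ 0}) {r : ℝ} (hr : 0 < r) :
    Integrable (fun θ : Metric.sphere (0:E) 1 => f (r • (θ:E))) (volume : Measure E).toSphere := by
  have hc : Continuous fun θ : Metric.sphere (0:E) 1 => f (r • (θ:E)) :=
    hf.comp_continuous (by fun_prop) fun θ => smul_sphere_ne_zero hr θ
  exact hc.integrable_of_hasCompactSupport (HasCompactSupport.of_compactSpace _)

/-- Integration by parts on a sphere along a rotation field. -/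
lemma integral_toSphere_skew_mul {J : E →L[ℝ] E} (hJ : ∀ x, inner ℝ (J x) x = 0)
    (hf : ContDiffOn ℝ 1 f {x | x ≠ 0}) (hg : ContDiffOn ℝ 1 g {x | x ≠ 0}) {r : ℝ}
    (hr : 0 < r) :
    ∫ θ : Metric.sphere (0:E) 1, fderiv ℝ f (r • (θ:E)) (J (r • (θ:E))) * g (r • (θ:E))
      ∂(volume : Measure E).toSphere =
    -∫ θ : Metric.sphere (0:E) 1, f (r • (θ:E)) * fderiv ℝ g (r • (θ:E)) (J (r • (θ:E)))
      ∂(volume : Measure E).toSphere := by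
  have h := integral_toSphere_skew hJ (hf.mul hg) hr
  have h1 := integrable_toSphere
    (f := fun x => fderiv ℝ f x (J x) * g x) (hf.continuousOn_skew.mul hg.continuousOn) hr
  have h2 := integrable_toSphere
    (f := fun x => f x * fderiv ℝ g x (J x)) (hf.continuousOn.mul hg.continuousOn_skew) hr
  have heq : ∀ θ : Metric.sphere (0:E) 1,
      fderiv ℝ (fun x => f x * g x) (r • (θ:E)) (J (r • (θ:E))) =
      fderiv ℝ f (r • (θ:E)) (J (r • (θ:E))) * g (r • (θ:E)) +
      f (r • (θ:E)) * fderiv ℝ g (r • (θ:E)) (J (r • (θ:E))) := fun θ => by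
    have hne := smul_sphere_ne_zero hr θ
    have hm : fderiv ℝ (fun x => f x * g x) (r • (θ:E)) = _ :=
      HasFDerivAt.fderiv (f := fun x => f x * g x)
        ((hf.hasFDerivAt_of_ne_zero hne).mul (hg.hasFDerivAt_of_ne_zero hne))
    rw [hm]
    simp
    ring
  have h' : ∫ θ : Metric.sphere (0:E) 1, (fderiv ℝ f (r • (θ:E)) (J (r • (θ:E))) * g (r • (θ:E)) +
      f (r • (θ:E)) * fderiv ℝ g (r • (θ:E)) (J (r • (θ:E)))) ∂(volume : Measure E).toSphere = 0 := by
    rw [← h]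
    exact integral_congr_ae (ae_of_all _ fun θ => (heq θ).symm)
  rw [integral_add h1 h2] at h'
  linarith

lemma integral_toSphere_skew_skew_mul {J : E →L[ℝ] E} (hJ : ∀ x, inner ℝ (J x) x = 0)
    (hf : ContDiffOn ℝ 2 f {x | x ≠ 0}) (hg : ContDiffOn ℝ 2 g {x | x ≠ 0}) {r : ℝ}
    (hr : 0 < r) :
    ∫ θ : Metric.sphere (0:E) 1,
      fderiv ℝ (fun x => fderiv ℝ f x (J x)) (r • (θ:E)) (J (r • (θ:E))) * g (r • (θ:E))
      ∂(volume : Measure E).toSphere =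
    ∫ θ : Metric.sphere (0:E) 1,
      f (r • (θ:E)) * fderiv ℝ (fun x => fderiv ℝ g x (J x)) (r • (θ:E)) (J (r • (θ:E)))
      ∂(volume : Measure E).toSphere := by
  have h1 := integral_toSphere_skew_mul hJ (hf.skew (J := J)) (hg.of_le (by norm_num)) hr
  have h2 := integral_toSphere_skew_mul hJ (hf.of_le (by norm_num)) (hg.skew (J := J)) hr
  rw [h1, h2, neg_neg]

end Rotation

section SphericalLaplacian

variable {N : ℕ}

/-- The infinitesimal rotation in the plane spanned by the coordinate vectors `a` and `b`. -/
noncomputable def rot (a b : Fin N) : EuclideanSpace ℝ (Fin N) →L[ℝ] EuclideanSpace ℝ (Fin N) :=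
  (EuclideanSpace.proj a).smulRight (EuclideanSpace.single b 1) -
    (EuclideanSpace.proj b).smulRight (EuclideanSpace.single a 1)

lemma rot_apply (a b : Fin N) (x : EuclideanSpace ℝ (Fin N)) :
    rot a b x = x a • EuclideanSpace.single b 1 - x b • EuclideanSpace.single a 1 := rfl

lemma inner_rot_self (a b : Fin N) (x : EuclideanSpace ℝ (Fin N)) :
    inner ℝ (rot a b x) x = 0 := by
  rw [rot_apply, inner_sub_left, real_inner_smul_left, real_inner_smul_left]
  simp [EuclideanSpace.inner_single_left]
  ring

lemma sum_smul_single (x : EuclideanSpace ℝ (Fin N)) :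
    ∑ a, x a • EuclideanSpace.single a (1:ℝ) = x := by
  ext i
  simp [Finset.sum_apply, Pi.single_apply]

lemma sum_rot_bilin (B : EuclideanSpace ℝ (Fin N) →L[ℝ] EuclideanSpace ℝ (Fin N) →L[ℝ] ℝ)
    (x : EuclideanSpace ℝ (Fin N)) :
    ∑ a, ∑ b, B (rot a b x) (rot a b x) =
      2 * (‖x‖ ^ 2 * ∑ i, B (EuclideanSpace.single i 1) (EuclideanSpace.single i 1) - B x x) := by
  have hx' : B x x = ∑ a, ∑ b, x a * x b *
      B (EuclideanSpace.single b 1) (EuclideanSpace.single a 1) := by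
    conv_lhs => rw [← sum_smul_single x]
    simp [Finset.mul_sum, mul_assoc]
  have hx : B x x = ∑ a, ∑ b, x a * x b *
      B (EuclideanSpace.single a 1) (EuclideanSpace.single b 1) := by
    rw [hx', Finset.sum_comm]
    simp [mul_comm]
  have h : ∀ a b, B (rot a b x) (rot a b x) =
      x a ^ 2 * B (EuclideanSpace.single b 1) (EuclideanSpace.single b 1) +
      x b ^ 2 * B (EuclideanSpace.single a 1) (EuclideanSpace.single a 1) -
      x a * x b * B (EuclideanSpace.single a 1) (EuclideanSpace.single b 1) -
      x a * x b * B (EuclideanSpace.single b 1) (EuclideanSpace.single a 1) := fun a b => by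
    rw [rot_apply]
    simp
    ring
  simp only [h, Finset.sum_sub_distrib, Finset.sum_add_distrib, ← hx, ← hx']
  simp only [← Finset.mul_sum, ← Finset.sum_mul, EuclideanSpace.real_norm_sq_eq]
  ring

lemma sum_rot_rot (ℓ : EuclideanSpace ℝ (Fin N) →L[ℝ] ℝ) (x : EuclideanSpace ℝ (Fin N)) :
    ∑ a, ∑ b, ℓ (rot a b (rot a b x)) = -2 * ((N:ℝ) - 1) * ℓ x := by
  have hx : ℓ x = ∑ a, x a * ℓ (EuclideanSpace.single a 1) := by
    conv_lhs => rw [← sum_smul_single x]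
    simp
  have h : ∀ a b, ℓ (rot a b (rot a b x)) =
      (if a = b then x a * ℓ (EuclideanSpace.single b 1) else 0) +
      (if a = b then x b * ℓ (EuclideanSpace.single a 1) else 0) -
      x b * ℓ (EuclideanSpace.single b 1) - x a * ℓ (EuclideanSpace.single a 1) := fun a b => by
    rw [rot_apply, rot_apply]
    rcases eq_or_ne a b with rfl | hab
    · simp
    · simp [hab, hab.symm]
  simp only [h, Finset.sum_sub_distrib, Finset.sum_add_distrib]
  simp [← Finset.mul_sum, ← hx]
  ring

lemma fderiv_skew {f : EuclideanSpace ℝ (Fin N) → ℝ} (hf : ContDiffOn ℝ 2 f {x | x ≠ 0})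
    {J : EuclideanSpace ℝ (Fin N) →L[ℝ] EuclideanSpace ℝ (Fin N)}
    {x : EuclideanSpace ℝ (Fin N)} (hx : x ≠ 0) (v : EuclideanSpace ℝ (Fin N)) :
    fderiv ℝ (fun y => fderiv ℝ f y (J y)) x v =
      fderiv ℝ (fderiv ℝ f) x v (J x) + fderiv ℝ f x (J v) := by
  have h1 : HasFDerivAt (fderiv ℝ f) (fderiv ℝ (fderiv ℝ f) x) x :=
    (hf.fderiv_of_isOpen isOpen_ne (m := 1) (by norm_num)).hasFDerivAt_of_ne_zero hx
  rw [(h1.clm_apply (J.hasFDerivAt (x := x))).fderiv]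
  simp
  ring

lemma lap_eq {f : EuclideanSpace ℝ (Fin N) → ℝ} (hf : ContDiffOn ℝ 2 f {x | x ≠ 0})
    {x : EuclideanSpace ℝ (Fin N)} (hx : x ≠ 0) :
    lap f x = ∑ i, fderiv ℝ (fderiv ℝ f) x (EuclideanSpace.single i 1)
      (EuclideanSpace.single i 1) := by
  have h1 : HasFDerivAt (fderiv ℝ f) (fderiv ℝ (fderiv ℝ f) x) x :=
    (hf.fderiv_of_isOpen isOpen_ne (m := 1) (by norm_num)).hasFDerivAt_of_ne_zero hx
  refine Finset.sum_congr rfl fun i _ => ?_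
  rw [(h1.clm_apply (hasFDerivAt_const (EuclideanSpace.single i (1:ℝ)) x)).fderiv]
  simp

/-- Twice the spherical Laplacian, as a sum of squares of rotation fields. -/
noncomputable def sphLap (f : EuclideanSpace ℝ (Fin N) → ℝ) (x : EuclideanSpace ℝ (Fin N)) : ℝ :=
  ∑ a, ∑ b, fderiv ℝ (fun y => fderiv ℝ f y (rot a b y)) x (rot a b x)

/-- Decomposition of the Laplacian into radial and spherical parts. -/
lemma norm_sq_mul_lap {f : EuclideanSpace ℝ (Fin N) → ℝ} (hf : ContDiffOn ℝ 2 f {x | x ≠ 0})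
    {x : EuclideanSpace ℝ (Fin N)} (hx : x ≠ 0) :
    ‖x‖ ^ 2 * lap f x =
      fderiv ℝ (fderiv ℝ f) x x x + ((N:ℝ) - 1) * fderiv ℝ f x x + sphLap f x / 2 := by
  simp only [sphLap, fderiv_skew hf hx, Finset.sum_add_distrib, sum_rot_rot, sum_rot_bilin,
    ← lap_eq hf hx]
  ring

lemma integral_toSphere_sphLap_mul {f g : EuclideanSpace ℝ (Fin N) → ℝ}
    (hf : ContDiffOn ℝ 2 f {x | x ≠ 0}) (hg : ContDiffOn ℝ 2 g {x | x ≠ 0}) {r : ℝ}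
    (hr : 0 < r) :
    ∫ θ : Metric.sphere (0 : EuclideanSpace ℝ (Fin N)) 1,
      sphLap f (r • (θ : EuclideanSpace ℝ (Fin N))) * g (r • (θ : EuclideanSpace ℝ (Fin N)))
        ∂(volume : Measure (EuclideanSpace ℝ (Fin N))).toSphere =
    ∫ θ : Metric.sphere (0 : EuclideanSpace ℝ (Fin N)) 1,
      f (r • (θ : EuclideanSpace ℝ (Fin N))) * sphLap g (r • (θ : EuclideanSpace ℝ (Fin N)))
        ∂(volume : Measure (EuclideanSpace ℝ (Fin N))).toSphere := by
  simp only [sphLap, Finset.sum_mul, Finset.mul_sum]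
  have hi : ∀ a b, ContinuousOn (fun x => fderiv ℝ (fun y => fderiv ℝ f y (rot a b y)) x
      (rot a b x) * g x) {x | x ≠ 0} := fun a b =>
    (hf.skew (J := rot a b)).continuousOn_skew.mul hg.continuousOn
  have hi' : ∀ a b, ContinuousOn (fun x => f x * fderiv ℝ (fun y => fderiv ℝ g y (rot a b y)) x
      (rot a b x)) {x | x ≠ 0} := fun a b =>
    hf.continuousOn.mul (hg.skew (J := rot a b)).continuousOn_skew
  rw [integral_finsetSum _ fun a _ => integrable_finsetSum _ fun b _ =>
      integrable_toSphere (hi a b) hr,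
    integral_finsetSum _ fun a _ => integrable_finsetSum _ fun b _ =>
      integrable_toSphere (hi' a b) hr]
  refine Finset.sum_congr rfl fun a _ => ?_
  rw [integral_finsetSum _ fun b _ => integrable_toSphere (hi a b) hr,
    integral_finsetSum _ fun b _ => integrable_toSphere (hi' a b) hr]
  exact Finset.sum_congr rfl fun b _ =>
    integral_toSphere_skew_skew_mul (fun x => inner_rot_self a b x) hf hg hr

end SphericalLaplacian

section Modes

/-- Euclidean `N`-space. -/
abbrev Eu (N : ℕ) := EuclideanSpace ℝ (Fin N)

/-- The unit sphere of Euclidean `N`-space. -/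
abbrev Sph (N : ℕ) := Metric.sphere (0 : Eu N) 1

/-- The surface measure of the unit sphere. -/
noncomputable abbrev sphMeas (N : ℕ) : Measure (Sph N) := (volume : Measure (Eu N)).toSphere

/-- A harmonic function which is homogeneous of degree `j`. -/
def SolidHarmonic {N : ℕ} (j : ℕ) (P : Eu N → ℝ) : Prop :=
  ContDiff ℝ 2 P ∧ (∀ (r : ℝ) (x : Eu N), P (r • x) = r ^ j * P x) ∧ ∀ x, lap P x = 0

variable {N : ℕ}

lemma hasDerivAt_radial {w : Eu N → ℝ} (hw : ContDiffOn ℝ 1 w {x | x ≠ 0}) {r : ℝ} {x : Eu N}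
    (hx : r • x ≠ 0) : HasDerivAt (fun s : ℝ => w (s • x)) (fderiv ℝ w (r • x) x) r := by
  have := (hw.hasFDerivAt_of_ne_zero hx).comp_hasDerivAt r ((hasDerivAt_id r).smul_const x)
  simpa [Function.comp_def] using this

lemma hasDerivAt_radial_deriv {w : Eu N → ℝ} (hw : ContDiffOn ℝ 2 w {x | x ≠ 0}) {r : ℝ}
    {x : Eu N} (hx : r • x ≠ 0) :
    HasDerivAt (fun s : ℝ => fderiv ℝ w (s • x) x) (fderiv ℝ (fderiv ℝ w) (r • x) x x) r := by
  have h1 := ((hw.fderiv_of_isOpen isOpen_ne (m := 1) (by norm_num)).hasFDerivAt_of_ne_zero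
    hx).comp_hasDerivAt r ((hasDerivAt_id r).smul_const x)
  have := h1.clm_apply (hasDerivAt_const r x)
  simpa using this

/-- The radial derivatives of a function with a prescribed radial profile. -/
lemma radial_fderiv_eq {w : Eu N → ℝ} (hw : ContDiffOn ℝ 2 w {x | x ≠ 0}) {x : Eu N} (hx : x ≠ 0)
    {g g' : ℝ → ℝ} {g'' : ℝ} (hg : ∀ s > 0, w (s • x) = g s) (hg' : ∀ s > 0, HasDerivAt g (g' s) s)
    (hg'' : HasDerivAt g' g'' 1) :
    fderiv ℝ w x x = g' 1 ∧ fderiv ℝ (fderiv ℝ w) x x x = g'' := by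
  have hne : ∀ s : ℝ, 0 < s → s • x ≠ 0 := fun s hs => smul_ne_zero hs.ne' hx
  have h1 : ∀ s > 0, fderiv ℝ w (s • x) x = g' s := fun s hs => by
    refine (hasDerivAt_radial (hw.of_le (by norm_num)) (hne s hs)).unique ?_
    refine (hg' s hs).congr_of_eventuallyEq ?_
    filter_upwards [Ioi_mem_nhds hs] with u hu using hg u hu
  have h2 : fderiv ℝ (fderiv ℝ w) ((1:ℝ) • x) x x = g'' := by
    refine (hasDerivAt_radial_deriv hw (hne 1 one_pos)).unique ?_
    refine hg''.congr_of_eventuallyEq ?_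
    filter_upwards [Ioi_mem_nhds one_pos] with u hu using h1 u hu
  exact ⟨by simpa using h1 1 one_pos, by simpa using h2⟩

lemma SolidHarmonic.sphLap_eq {j : ℕ} {P : Eu N → ℝ} (hP : SolidHarmonic j P) {x : Eu N}
    (hx : x ≠ 0) : sphLap P x = -2 * (j * (j + N - 2)) * P x := by
  obtain ⟨h1, h2⟩ := radial_fderiv_eq hP.1.contDiffOn hx
    (g := fun s => s ^ j * P x) (g' := fun s => (j * s ^ (j - 1)) * P x)
    (g'' := (j * ((j - 1 : ℕ) * (1:ℝ) ^ (j - 1 - 1))) * P x)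
    (fun s _ => hP.2.1 s x) (fun s _ => (hasDerivAt_pow j s).mul_const _)
    (((hasDerivAt_pow (j - 1) (1:ℝ)).const_mul _).mul_const _)
  have h := norm_sq_mul_lap hP.1.contDiffOn hx
  rw [hP.2.2, h1, h2] at h
  rcases j with _ | j
  · simp at h ⊢
    linarith
  · simp at h ⊢
    linarith

lemma continuousOn_smul_sphere {F : Type*} [TopologicalSpace F] {f : Eu N → F}
    (hf : ContinuousOn f {x | x ≠ 0}) :
    ContinuousOn (fun p : ℝ × Sph N => f (p.1 • (p.2 : Eu N))) (Ioi 0 ×ˢ univ) := by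
  refine hf.comp (f := fun p : ℝ × Sph N => p.1 • (p.2 : Eu N)) (by fun_prop) fun p hp => ?_
  exact smul_sphere_ne_zero hp.1 p.2

/-- The component of `w` along `P` on the sphere of radius `r`. -/
noncomputable def mode (w P : Eu N → ℝ) (r : ℝ) : ℝ :=
  ∫ θ : Sph N, w (r • (θ : Eu N)) * P θ ∂sphMeas N

lemma hasDerivAt_mode {w P : Eu N → ℝ} (hw : ContDiffOn ℝ 1 w {x | x ≠ 0}) (hP : Continuous P)
    {r : ℝ} (hr : 0 < r) :
    HasDerivAt (mode w P) (∫ θ : Sph N, fderiv ℝ w (r • (θ : Eu N)) θ * P θ ∂sphMeas N) r := by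
  refine hasDerivAt_integral_of_compactSpace (sphMeas N) (U := Ioi 0) isOpen_Ioi
    (G := fun r (θ : Sph N) => w (r • (θ : Eu N)) * P θ)
    (G' := fun r (θ : Sph N) => fderiv ℝ w (r • (θ : Eu N)) θ * P θ) ?_ ?_ ?_ hr
  · exact (continuousOn_smul_sphere hw.continuousOn).mul (by fun_prop)
  · exact ((continuousOn_smul_sphere hw.continuousOn_fderiv_ne_zero).clm_apply (by fun_prop)).mul
      (by fun_prop)
  · exact fun s hs θ => (hasDerivAt_radial hw (smul_sphere_ne_zero hs θ)).mul_const _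

lemma hasDerivAt_deriv_mode {w P : Eu N → ℝ} (hw : ContDiffOn ℝ 2 w {x | x ≠ 0})
    (hP : Continuous P) {r : ℝ} (hr : 0 < r) :
    HasDerivAt (deriv (mode w P))
      (∫ θ : Sph N, fderiv ℝ (fderiv ℝ w) (r • (θ : Eu N)) θ θ * P θ ∂sphMeas N) r := by
  have hw1 : ContDiffOn ℝ 1 w {x | x ≠ 0} := hw.of_le (by norm_num)
  have hw' : ContDiffOn ℝ 1 (fderiv ℝ w) {x | x ≠ 0} :=
    hw.fderiv_of_isOpen isOpen_ne (m := 1) (by norm_num)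
  have h := hasDerivAt_integral_of_compactSpace (sphMeas N) (U := Ioi 0) isOpen_Ioi
    (G := fun r (θ : Sph N) => fderiv ℝ w (r • (θ : Eu N)) θ * P θ)
    (G' := fun r (θ : Sph N) => fderiv ℝ (fderiv ℝ w) (r • (θ : Eu N)) θ θ * P θ) ?_ ?_ ?_ hr
  · refine h.congr_of_eventuallyEq ?_
    filter_upwards [Ioi_mem_nhds hr] with s hs using (hasDerivAt_mode hw1 hP hs).deriv
  · exact ((continuousOn_smul_sphere hw1.continuousOn_fderiv_ne_zero).clm_apply (by fun_prop)).mul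
      (by fun_prop)
  · exact (((continuousOn_smul_sphere hw'.continuousOn_fderiv_ne_zero).clm_apply
      (by fun_prop)).clm_apply (by fun_prop)).mul (by fun_prop)
  · exact fun s hs θ => (hasDerivAt_radial_deriv hw (smul_sphere_ne_zero hs θ)).mul_const _

lemma contDiffOn_mode {w P : Eu N → ℝ} (hw : ContDiffOn ℝ 2 w {x | x ≠ 0})
    (hP : Continuous P) : ContDiffOn ℝ 2 (mode w P) (Ioi 0) := by
  have hw1 : ContDiffOn ℝ 1 w {x | x ≠ 0} := hw.of_le (by norm_num)
  have hw' : ContDiffOn ℝ 1 (fderiv ℝ w) {x | x ≠ 0} :=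
    hw.fderiv_of_isOpen isOpen_ne (m := 1) (by norm_num)
  rw [show (2 : WithTop ℕ∞) = 1 + 1 by norm_num, contDiffOn_succ_iff_deriv_of_isOpen isOpen_Ioi]
  refine ⟨fun r hr => (hasDerivAt_mode hw1 hP hr).differentiableAt.differentiableWithinAt,
    by simp, ?_⟩
  rw [show (1 : WithTop ℕ∞) = 0 + 1 by norm_num, contDiffOn_succ_iff_deriv_of_isOpen isOpen_Ioi]
  refine ⟨fun r hr => (hasDerivAt_deriv_mode hw hP hr).differentiableAt.differentiableWithinAt,
    by simp, ?_⟩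
  rw [contDiffOn_zero]
  refine ContinuousOn.congr (continuousOn_integral_of_compactSpace (sphMeas N) isOpen_Ioi
    (G := fun r (θ : Sph N) => fderiv ℝ (fderiv ℝ w) (r • (θ : Eu N)) θ θ * P θ) ?_)
    fun r hr => (hasDerivAt_deriv_mode hw hP hr).deriv
  exact (((continuousOn_smul_sphere hw'.continuousOn_fderiv_ne_zero).clm_apply
      (by fun_prop)).clm_apply (by fun_prop)).mul (by fun_prop)

/-- The ordinary differential equation satisfied by the component of `w` along a solid harmonic. -/
lemma mode_ode {w P : Eu N → ℝ} (hw : ContDiffOn ℝ 2 w {x | x ≠ 0}) {j : ℕ}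
    (hP : SolidHarmonic j P) {r : ℝ} (hr : 0 < r) :
    deriv (deriv (mode w P)) r + (N - 1) / r * deriv (mode w P) r -
      j * (j + N - 2) / r ^ 2 * mode w P r = mode (lap w) P r := by
  have hw1 : ContDiffOn ℝ 1 w {x | x ≠ 0} := hw.of_le (by norm_num)
  have hw' : ContDiffOn ℝ 1 (fderiv ℝ w) {x | x ≠ 0} :=
    hw.fderiv_of_isOpen isOpen_ne (m := 1) (by norm_num)
  have hPc := hP.1.continuous
  have hPθ : ∀ θ : Sph N, P (r • (θ : Eu N)) = r ^ j * P θ := fun θ => hP.2.1 r θ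
  have hsph : ∫ θ : Sph N, sphLap w (r • (θ : Eu N)) * P θ ∂sphMeas N =
      -2 * (j * (j + N - 2)) * mode w P r := by
    have h := integral_toSphere_sphLap_mul hw hP.1.contDiffOn hr
    have h1 : ∀ θ : Sph N, w (r • (θ : Eu N)) * sphLap P (r • (θ : Eu N)) =
        r ^ j * (-2 * (j * (j + N - 2))) * (w (r • (θ : Eu N)) * P θ) := fun θ => by
      rw [hP.sphLap_eq (smul_sphere_ne_zero hr θ), hPθ]
      ring
    have h2 : ∀ θ : Sph N, sphLap w (r • (θ : Eu N)) * P (r • (θ : Eu N)) =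
        r ^ j * (sphLap w (r • (θ : Eu N)) * P θ) := fun θ => by
      rw [hPθ]
      ring
    simp only [h1, h2, integral_const_mul] at h
    rw [mul_assoc] at h
    exact mul_left_cancel₀ (pow_ne_zero j hr.ne') h
  have hi1 : Integrable (fun θ : Sph N => r ^ 2 * (fderiv ℝ (fderiv ℝ w) (r • (θ : Eu N)) θ θ *
      P θ)) (sphMeas N) := by
    refine Integrable.const_mul (Continuous.integrable_of_hasCompactSupport ?_
      (HasCompactSupport.of_compactSpace _)) _
    exact (((hw'.continuousOn_fderiv_ne_zero.comp_continuous (by fun_prop) fun θ =>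
      smul_sphere_ne_zero hr θ).clm_apply (by fun_prop)).clm_apply (by fun_prop)).mul (by fun_prop)
  have hi2 : Integrable (fun θ : Sph N => (N - 1) * r * (fderiv ℝ w (r • (θ : Eu N)) θ *
      P θ)) (sphMeas N) := by
    refine Integrable.const_mul (Continuous.integrable_of_hasCompactSupport ?_
      (HasCompactSupport.of_compactSpace _)) _
    exact ((hw1.continuousOn_fderiv_ne_zero.comp_continuous (by fun_prop) fun θ =>
      smul_sphere_ne_zero hr θ).clm_apply (by fun_prop)).mul (by fun_prop)
  have hi3 : Integrable (fun θ : Sph N => 1 / 2 * (sphLap w (r • (θ : Eu N)) * P θ))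
      (sphMeas N) := by
    refine Integrable.const_mul (Continuous.integrable_of_hasCompactSupport ?_
      (HasCompactSupport.of_compactSpace _)) _
    refine Continuous.mul ?_ (by fun_prop)
    refine continuous_finsetSum _ fun a _ => continuous_finsetSum _ fun b _ => ?_
    exact (hw.skew (J := rot a b)).continuousOn_skew.comp_continuous (by fun_prop) fun θ =>
      smul_sphere_ne_zero hr θ
  have hlap : r ^ 2 * mode (lap w) P r = r ^ 2 * deriv (deriv (mode w P)) r +
      (N - 1) * r * deriv (mode w P) r + 1 / 2 * (-2 * (j * (j + N - 2)) * mode w P r) := by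
    rw [← hsph, (hasDerivAt_mode hw1 hPc hr).deriv, (hasDerivAt_deriv_mode hw hPc hr).deriv, mode,
      ← integral_const_mul, ← integral_const_mul, ← integral_const_mul, ← integral_const_mul,
      ← integral_add hi1 hi2]
    refine Eq.trans ?_ (integral_add (hi1.add hi2) hi3)
    refine integral_congr_ae (ae_of_all _ fun θ => ?_)
    have h := norm_sq_mul_lap hw (smul_sphere_ne_zero hr θ)
    simp [norm_smul, abs_of_pos hr] at h ⊢
    rw [← mul_assoc, h]
    ring
  have h2 : mode (lap w) P r = (r ^ 2 * mode (lap w) P r) / r ^ 2 := by field_simp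
  rw [h2, hlap]
  field_simp
  ring

end Modes

section Polar

variable {N : ℕ}

lemma Integrable.integral_sphere {f : Eu N → ℝ} (hf : Integrable f) :
    IntegrableOn (fun r : ℝ => r ^ (N - 1) * ∫ θ : Sph N, f (r • (θ : Eu N)) ∂sphMeas N)
      (Ioi 0) := by
  have h1 : Integrable (fun x : ({0}ᶜ : Set (Eu N)) => f x)
      ((volume : Measure (Eu N)).comap (↑)) :=
    (integrableOn_iff_comap_subtypeVal (measurableSet_singleton _).compl).1 hf.integrableOn
  have hmp := (volume : Measure (Eu N)).measurePreserving_homeomorphUnitSphereProd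
  have h2 : Integrable (fun p : Sph N × Ioi (0:ℝ) => f ((p.2 : ℝ) • (p.1 : Eu N)))
      ((sphMeas N).prod (Measure.volumeIoiPow (N - 1))) := by
    have := (hmp.integrable_comp_emb (g := fun p : Sph N × Ioi (0:ℝ) => f ((p.2 : ℝ) • (p.1 : Eu N)))
      (Homeomorph.measurableEmbedding _)).1 ?_
    · simpa using this
    · refine h1.congr (ae_of_all _ fun x => ?_)
      have := (homeomorphUnitSphereProd (Eu N)).symm_apply_apply x
      have h3 := congrArg Subtype.val this
      rw [homeomorphUnitSphereProd_symm_apply_coe] at h3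
      simp only [Function.comp_apply, h3]
  have h3 := h2.integral_prod_right
  rw [Measure.volumeIoiPow, integrable_withDensity_iff_integrable_smul' (by fun_prop)
    (ae_of_all _ fun _ => ENNReal.ofReal_lt_top)] at h3
  rw [integrableOn_iff_comap_subtypeVal measurableSet_Ioi]
  refine h3.congr (ae_of_all _ fun r => ?_)
  simp [ENNReal.toReal_ofReal (pow_nonneg r.2.le (N - 1))]

lemma sq_integral_mul_le {K : Type*} [TopologicalSpace K] [CompactSpace K] [MeasurableSpace K]
    [OpensMeasurableSpace K] (μ : Measure K) [IsFiniteMeasure μ] {f g : K → ℝ}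
    (hf : Continuous f) (hg : Continuous g) :
    (∫ θ, f θ * g θ ∂μ) ^ 2 ≤ (∫ θ, f θ ^ 2 ∂μ) * ∫ θ, g θ ^ 2 ∂μ := by
  have hi : ∀ {h : K → ℝ}, Continuous h → Integrable h μ := fun hh =>
    hh.integrable_of_hasCompactSupport (HasCompactSupport.of_compactSpace _)
  have h : ∀ s : ℝ, 0 ≤ (∫ θ, g θ ^ 2 ∂μ) * (s * s) + (-2 * ∫ θ, f θ * g θ ∂μ) * s +
      ∫ θ, f θ ^ 2 ∂μ := fun s => by
    have h0 : 0 ≤ ∫ θ, (f θ - s * g θ) ^ 2 ∂μ := integral_nonneg fun θ => sq_nonneg _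
    have h1 : ∫ θ, (f θ - s * g θ) ^ 2 ∂μ =
        ∫ θ, (s * s) * g θ ^ 2 + (-2 * s) * (f θ * g θ) + f θ ^ 2 ∂μ := by
      congr 1 with θ
      ring
    rw [h1, integral_add (hi (by fun_prop)) (hi (by fun_prop)),
      integral_add (hi (by fun_prop)) (hi (by fun_prop)), integral_const_mul,
      integral_const_mul] at h0
    linarith
  have := discrim_le_zero h
  rw [discrim] at this
  linarith

end Polar

section Emden

/-- The Emden–Fowler radial variable. -/
noncomputable def emden (α r : ℝ) : ℝ := 2 / (2 + α) * r ^ ((2 + α) / 2)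

/-- The inverse of the Emden–Fowler radial variable. -/
noncomputable def emdenInv (α t : ℝ) : ℝ := ((2 + α) / 2 * t) ^ (2 / (2 + α))

variable {α : ℝ}

lemma emden_pos (hα : 0 < α) {r : ℝ} (hr : 0 < r) : 0 < emden α r :=
  mul_pos (by positivity) (Real.rpow_pos_of_pos hr _)

lemma emdenInv_pos (hα : 0 < α) {t : ℝ} (ht : 0 < t) : 0 < emdenInv α t :=
  Real.rpow_pos_of_pos (by positivity) _

lemma emden_emdenInv (hα : 0 < α) {t : ℝ} (ht : 0 < t) : emden α (emdenInv α t) = t := by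
  rw [emden, emdenInv, ← Real.rpow_mul (by positivity)]
  have : 2 / (2 + α) * ((2 + α) / 2) = 1 := by field_simp
  rw [this, Real.rpow_one, ← mul_assoc, this, one_mul]

lemma emdenInv_emden (hα : 0 < α) {r : ℝ} (hr : 0 < r) : emdenInv α (emden α r) = r := by
  have h : (2 + α) / 2 * (2 / (2 + α)) = 1 := by field_simp
  rw [emden, emdenInv, ← mul_assoc, h, one_mul, ← Real.rpow_mul hr.le, h, Real.rpow_one]

lemma hasDerivAt_emden (hα : 0 < α) {r : ℝ} (hr : 0 < r) :
    HasDerivAt (emden α) (r ^ (α / 2)) r := by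
  have := (Real.hasDerivAt_rpow_const (p := (2 + α) / 2) (Or.inl hr.ne')).const_mul (2 / (2 + α))
  have h : r ^ (α / 2) = 2 / (2 + α) * ((2 + α) / 2 * r ^ ((2 + α) / 2 - 1)) := by
    rw [show (2 + α) / 2 - 1 = α / 2 by ring]
    field_simp
  rw [h]
  exact this

lemma hasDerivAt_emdenInv (hα : 0 < α) {t : ℝ} (ht : 0 < t) :
    HasDerivAt (emdenInv α) (emdenInv α t ^ (-(α / 2))) t := by
  have hp : 0 < (2 + α) / 2 * t := by positivity
  have := (Real.hasDerivAt_rpow_const (p := 2 / (2 + α)) (Or.inl hp.ne')).comp t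
    ((hasDerivAt_id t).const_mul ((2 + α) / 2))
  have h : emdenInv α t ^ (-(α / 2)) =
      2 / (2 + α) * ((2 + α) / 2 * t) ^ (2 / (2 + α) - 1) * ((2 + α) / 2 * 1) := by
    rw [emdenInv, ← Real.rpow_mul hp.le,
      show 2 / (2 + α) * -(α / 2) = 2 / (2 + α) - 1 by field_simp; ring]
    field_simp
  rw [h]
  exact this

lemma contDiffOn_emdenInv (hα : 0 < α) : ContDiffOn ℝ 2 (emdenInv α) (Ioi 0) := by
  intro t ht
  have ht : 0 < t := ht
  exact ((contDiffAt_const.mul contDiffAt_id).rpow_const_of_ne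
    (by simp; constructor <;> positivity)).contDiffWithinAt

lemma contDiffOn_emden (α : ℝ) : ContDiffOn ℝ 2 (emden α) (Ioi 0) := fun _ hr =>
  (contDiffAt_const.mul (contDiffAt_id.rpow_const_of_ne (ne_of_gt hr))).contDiffWithinAt

/-- The Emden–Fowler change of variables for weighted integrability. -/
lemma integrableOn_emden_iff (hα : 0 < α) (p : ℝ) (g : ℝ → ℝ) :
    IntegrableOn (fun t => t ^ p * g t) (Ioi 0) ↔
      IntegrableOn (fun r => r ^ ((2 + α) / 2 * p + α / 2) * g (emden α r)) (Ioi 0) := by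
  have hm : 0 < 2 / (2 + α) := by positivity
  have h1 := integrableOn_Ioi_comp_mul_left_iff (fun t => t ^ p * g t) 0 hm
  rw [mul_zero] at h1
  rw [← h1, ← integrableOn_Ioi_comp_rpow_iff' (p := (2 + α) / 2) _ (by positivity)]
  have h2 : ∀ r ∈ Ioi (0:ℝ), r ^ ((2 + α) / 2 - 1) • ((2 / (2 + α) * r ^ ((2 + α) / 2)) ^ p *
      g (2 / (2 + α) * r ^ ((2 + α) / 2))) = (2 / (2 + α)) ^ p *
      (r ^ ((2 + α) / 2 * p + α / 2) * g (emden α r)) := fun r hr => by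
    rw [Real.mul_rpow hm.le (Real.rpow_nonneg (le_of_lt hr) _), ← Real.rpow_mul (le_of_lt hr),
      Real.rpow_add hr, show (2 + α) / 2 - 1 = α / 2 by ring, emden, smul_eq_mul]
    ring
  rw [integrableOn_congr_fun h2 measurableSet_Ioi]
  exact integrable_const_mul_iff (IsUnit.mk0 _ (Real.rpow_pos_of_pos hm _).ne') _

end Emden

section ModeSolution

variable {N : ℕ} {α : ℝ}

lemma kk_weight (hα : 0 < α) (N : ℕ) : (2 + α) / 2 * kk N α + α / 2 = N - 1 + α := by
  have : (2 + α) ≠ 0 := by positivity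
  rw [kk]
  field_simp
  ring

lemma one_lt_kk (hN : 3 ≤ N) (hα : 0 < α) : 1 < kk N α := by
  have : (3:ℝ) ≤ N := by exact_mod_cast hN
  rw [kk, lt_div_iff₀ (by positivity)]
  linarith

lemma rpow_natCast_sub_one (hN : 1 ≤ N) (r : ℝ) : r ^ ((N:ℝ) - 1) = r ^ (N - 1) := by
  rw [← Real.rpow_natCast, Nat.cast_sub hN, Nat.cast_one]

lemma hasDerivAt_comp_emdenInv (hα : 0 < α) {φ : ℝ → ℝ} {φ' t : ℝ} (ht : 0 < t)
    (h : HasDerivAt φ φ' (emdenInv α t)) :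
    HasDerivAt (fun t => φ (emdenInv α t)) (φ' * emdenInv α t ^ (-(α / 2))) t :=
  h.comp t (hasDerivAt_emdenInv hα ht)

/-- The second derivative in the Emden–Fowler variable. -/
lemma hasDerivAt_deriv_comp_emdenInv (hα : 0 < α) {φ : ℝ → ℝ} (hφ : ContDiffOn ℝ 2 φ (Ioi 0))
    {t : ℝ} (ht : 0 < t) :
    HasDerivAt (deriv fun t => φ (emdenInv α t))
      (emdenInv α t ^ (-α) * (deriv (deriv φ) (emdenInv α t) -
        α / 2 / emdenInv α t * deriv φ (emdenInv α t))) t := by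
  have hd : ∀ r > 0, HasDerivAt φ (deriv φ r) r := fun r hr =>
    ((hφ.differentiableOn (by norm_num)).differentiableAt (Ioi_mem_nhds hr)).hasDerivAt
  have hd2 : ∀ r > 0, HasDerivAt (deriv φ) (deriv (deriv φ) r) r := fun r hr =>
    (((hφ.deriv_of_isOpen isOpen_Ioi (m := 1) (by norm_num)).differentiableOn
      (by norm_num)).differentiableAt (Ioi_mem_nhds hr)).hasDerivAt
  have hr := emdenInv_pos hα ht
  have h := (hasDerivAt_comp_emdenInv hα ht (hd2 _ hr)).mul
    ((hasDerivAt_emdenInv hα ht).rpow_const (p := -(α / 2)) (Or.inl hr.ne'))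
  have h' : HasDerivAt (fun t => deriv φ (emdenInv α t) * emdenInv α t ^ (-(α / 2))) _ t := h
  have heq : (deriv fun t => φ (emdenInv α t)) =ᶠ[𝓝 t]
      fun t => deriv φ (emdenInv α t) * emdenInv α t ^ (-(α / 2)) := by
    filter_upwards [Ioi_mem_nhds ht] with s hs
    exact (hasDerivAt_comp_emdenInv hα hs (hd _ (emdenInv_pos hα hs))).deriv
  refine (h'.congr_of_eventuallyEq heq).congr_deriv ?_
  rw [Real.rpow_sub_one hr.ne', show -α = -(α / 2) + -(α / 2) by ring, Real.rpow_add hr]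
  ring

/-- The linear operator of the singular equation in the Emden–Fowler variable. -/
lemma emden_operator (hα : 0 < α) {φ : ℝ → ℝ} (hφ : ContDiffOn ℝ 2 φ (Ioi 0)) (l : ℝ)
    {t : ℝ} (ht : 0 < t) :
    -(deriv (deriv fun t => φ (emdenInv α t)) t) -
      kk N α / t * deriv (fun t => φ (emdenInv α t)) t +
      4 * l / (2 + α) ^ 2 / t ^ 2 * φ (emdenInv α t) =
    -(emdenInv α t ^ (-α) * (deriv (deriv φ) (emdenInv α t) +
      (N - 1) / emdenInv α t * deriv φ (emdenInv α t) -
      l / emdenInv α t ^ 2 * φ (emdenInv α t))) := by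
  have hr := emdenInv_pos hα ht
  have hd : HasDerivAt φ (deriv φ (emdenInv α t)) (emdenInv α t) :=
    ((hφ.differentiableOn (by norm_num)).differentiableAt (Ioi_mem_nhds hr)).hasDerivAt
  rw [(hasDerivAt_deriv_comp_emdenInv hα hφ ht).deriv,
    (hasDerivAt_comp_emdenInv hα ht hd).deriv]
  have ht' : t = 2 / (2 + α) * (emdenInv α t * emdenInv α t ^ (α / 2)) := by
    conv_lhs => rw [← emden_emdenInv hα ht, emden, show (2 + α) / 2 = 1 + α / 2 by ring,
      Real.rpow_add hr, Real.rpow_one]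
  have h1 : emdenInv α t ^ (-(α / 2)) = (emdenInv α t ^ (α / 2))⁻¹ := Real.rpow_neg hr.le _
  have h2 : emdenInv α t ^ (-α) = (emdenInv α t ^ (α / 2))⁻¹ ^ 2 := by
    rw [← h1, sq, ← Real.rpow_add hr]
    ring_nf
  have h3 : emdenInv α t ^ (α / 2) ≠ 0 := (Real.rpow_pos_of_pos hr _).ne'
  have h4 : kk N α / t = (2 + α) / 2 * kk N α / (emdenInv α t * emdenInv α t ^ (α / 2)) := by
    conv_lhs => rw [ht']
    field_simp
  have h5 : 4 * l / (2 + α) ^ 2 / t ^ 2 =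
      l / (emdenInv α t * emdenInv α t ^ (α / 2)) ^ 2 := by
    conv_lhs => rw [ht']
    field_simp
    ring
  rw [h4, h5, h1, h2, eq_sub_of_add_eq (kk_weight hα N)]
  field_simp
  ring

lemma memE_comp_emdenInv (hN : 1 ≤ N) (hα : 0 < α) {φ : ℝ → ℝ} (hφ : ContDiffOn ℝ 2 φ (Ioi 0))
    (h0 : IntegrableOn (fun r => r ^ (N - 1) * (r ^ α * φ r ^ 2)) (Ioi 0))
    (h1 : IntegrableOn (fun r => r ^ (N - 1) * deriv φ r ^ 2) (Ioi 0)) :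
    memE (kk N α) fun t => φ (emdenInv α t) := by
  refine ⟨(hφ.of_le (by norm_num)).comp ((contDiffOn_emdenInv hα).of_le (by norm_num))
    fun t ht => emdenInv_pos hα ht, ?_⟩
  rw [integrableOn_emden_iff hα]
  refine (h1.add h0).congr_fun (fun r hr => ?_) measurableSet_Ioi
  have hr : 0 < r := hr
  have hd : HasDerivAt φ (deriv φ (emdenInv α (emden α r))) (emdenInv α (emden α r)) := by
    rw [emdenInv_emden hα hr]
    exact ((hφ.differentiableOn (by norm_num)).differentiableAt (Ioi_mem_nhds hr)).hasDerivAt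
  simp only [Pi.add_apply]
  rw [(hasDerivAt_comp_emdenInv hα (emden_pos hα hr) hd).deriv, emdenInv_emden hα hr,
    kk_weight hα, Real.rpow_add hr, rpow_natCast_sub_one hN, mul_pow, ← Real.rpow_mul_natCast hr.le,
    show -(α / 2) * (2:ℕ) = -α by push_cast; ring, Real.rpow_neg hr.le]
  have := (Real.rpow_pos_of_pos hr α).ne'
  field_simp

lemma mode_sq_le {w P : Eu N → ℝ} (hw : ContinuousOn w {x | x ≠ 0}) (hP : Continuous P) {r : ℝ}
    (hr : 0 < r) :
    mode w P r ^ 2 ≤ (∫ θ : Sph N, w (r • (θ : Eu N)) ^ 2 ∂sphMeas N) *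
      ∫ θ : Sph N, P θ ^ 2 ∂sphMeas N :=
  sq_integral_mul_le (sphMeas N) (f := fun θ : Sph N => w (r • (θ : Eu N)))
    (g := fun θ : Sph N => P θ)
    (hw.comp_continuous (by fun_prop) fun θ => smul_sphere_ne_zero hr θ) (by fun_prop)

lemma deriv_mode_sq_le {w P : Eu N → ℝ} (hw : ContDiffOn ℝ 1 w {x | x ≠ 0}) (hP : Continuous P)
    {r : ℝ} (hr : 0 < r) :
    deriv (mode w P) r ^ 2 ≤ (∫ θ : Sph N, ‖fderiv ℝ w (r • (θ : Eu N))‖ ^ 2 ∂sphMeas N) *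
      ∫ θ : Sph N, P θ ^ 2 ∂sphMeas N := by
  rw [(hasDerivAt_mode hw hP hr).deriv]
  have hc : Continuous fun θ : Sph N => fderiv ℝ w (r • (θ : Eu N)) :=
    hw.continuousOn_fderiv_ne_zero.comp_continuous (by fun_prop) fun θ =>
      smul_sphere_ne_zero hr θ
  have hi : ∀ {h : Sph N → ℝ}, Continuous h → Integrable h (sphMeas N) := fun hh =>
    hh.integrable_of_hasCompactSupport (HasCompactSupport.of_compactSpace _)
  refine (sq_integral_mul_le (sphMeas N) (f := fun θ : Sph N => fderiv ℝ w (r • (θ : Eu N)) θ)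
    (g := fun θ : Sph N => P θ) (hc.clm_apply (by fun_prop)) (by fun_prop)).trans ?_
  refine mul_le_mul_of_nonneg_right ?_ (integral_nonneg fun θ => sq_nonneg _)
  refine integral_mono (hi ((hc.clm_apply (by fun_prop)).pow 2)) (hi (hc.norm.pow 2)) fun θ => ?_
  have h := (fderiv ℝ w (r • (θ : Eu N))).le_opNorm θ
  rw [norm_eq_of_mem_sphere, mul_one] at h
  exact sq_le_sq' (abs_le.1 h).1 (abs_le.1 h).2

/-- The components of a solution of the linearized problem along solid harmonics solve the
singular Emden–Fowler equation. -/
lemma LinSolution.singSol {A : ℝ → ℝ} {w P : Eu N → ℝ} {j : ℕ} (hN : 1 ≤ N) (hα : 0 < α)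
    (hw : LinSolution N α (fun x => A (emden α ‖x‖)) w) (hP : SolidHarmonic j P) :
    SingSol (kk N α) A (4 * (j * (j + N - 2)) / (2 + α) ^ 2)
      fun t => mode w P (emdenInv α t) := by
  obtain ⟨hw2, heq, hi0, hi1⟩ := hw
  have hPc := hP.1.continuous
  have hw1 : ContDiffOn ℝ 1 w {x | x ≠ 0} := hw2.of_le (by norm_num)
  have hφ := contDiffOn_mode hw2 hPc
  refine ⟨hφ.comp (contDiffOn_emdenInv hα) fun t ht => emdenInv_pos hα ht,
    memE_comp_emdenInv hN hα hφ ?_ ?_, fun t ht => ?_⟩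
  · refine ContinuousOn.integrableOn_Ioi_of_le ?_
      ((Integrable.integral_sphere hi0).mul_const (∫ θ : Sph N, P θ ^ 2 ∂sphMeas N))
      fun r hr => ?_
    · exact (by fun_prop : Continuous fun r : ℝ => r ^ (N - 1)).continuousOn.mul
        ((continuousOn_rpow_Ioi α).mul (hφ.continuousOn.pow 2))
    · have hr : 0 < r := hr
      have h := mode_sq_le hw2.continuousOn hPc hr
      have h1 : ∫ θ : Sph N, ‖r • (θ : Eu N)‖ ^ α * w (r • (θ : Eu N)) ^ 2 ∂sphMeas N =
          r ^ α * ∫ θ : Sph N, w (r • (θ : Eu N)) ^ 2 ∂sphMeas N := by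
        rw [← integral_const_mul]
        congr 1 with θ
        rw [norm_smul, norm_eq_of_mem_sphere, mul_one, Real.norm_of_nonneg hr.le]
      rw [h1, abs_of_nonneg (by positivity)]
      have h2 := mul_le_mul_of_nonneg_left h
        (mul_nonneg (pow_nonneg hr.le (N - 1)) (Real.rpow_nonneg hr.le α))
      linarith
  · refine ContinuousOn.integrableOn_Ioi_of_le ?_
      ((Integrable.integral_sphere hi1).mul_const (∫ θ : Sph N, P θ ^ 2 ∂sphMeas N))
      fun r hr => ?_
    · exact (by fun_prop : Continuous fun r : ℝ => r ^ (N - 1)).continuousOn.mul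
        ((hφ.continuousOn_deriv_of_isOpen isOpen_Ioi (by norm_num)).pow 2)
    · have hr : 0 < r := hr
      have h := deriv_mode_sq_le hw1 hPc hr
      rw [abs_of_nonneg (by positivity)]
      have h2 := mul_le_mul_of_nonneg_left h (pow_nonneg hr.le (N - 1))
      linarith
  · have hr := emdenInv_pos hα ht
    rw [emden_operator hα hφ _ ht, mode_ode hw2 hP hr]
    have h1 : mode (lap w) P (emdenInv α t) =
        -(emdenInv α t ^ α * A t) * mode w P (emdenInv α t) := by
      rw [mode, mode, ← integral_const_mul]
      congr 1 with θ
      have h := heq _ (smul_sphere_ne_zero hr θ)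
      beta_reduce at h
      rw [norm_smul, norm_eq_of_mem_sphere, mul_one, Real.norm_of_nonneg hr.le,
        emden_emdenInv hα ht] at h
      rw [← neg_neg (lap w _), h]
      ring
    rw [h1, Real.rpow_neg hr.le]
    have := (Real.rpow_pos_of_pos hr α).ne'
    field_simp

end ModeSolution

section Existence

variable {N : ℕ} {α : ℝ}

lemma hasFDerivAt_norm_of_ne_zero {x : Eu N} (hx : x ≠ 0) :
    HasFDerivAt (fun y : Eu N => ‖y‖) (‖x‖⁻¹ • innerSL ℝ x) x := by
  have h := (hasStrictFDerivAt_norm_sq x).hasFDerivAt.sqrt (by simpa using hx)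
  simp only [Real.sqrt_sq (norm_nonneg _)] at h
  refine h.congr_fderiv ?_
  ext v
  simp
  field_simp

lemma hasFDerivAt_comp_norm {H : ℝ → ℝ} {H' : ℝ} {x : Eu N} (hx : x ≠ 0)
    (hH : HasDerivAt H H' ‖x‖) :
    HasFDerivAt (fun y : Eu N => H ‖y‖) (H' • ‖x‖⁻¹ • innerSL ℝ x) x :=
  hH.comp_hasFDerivAt x (hasFDerivAt_norm_of_ne_zero hx)

lemma contDiffOn_comp_norm {H : ℝ → ℝ} (hH : ContDiffOn ℝ 2 H (Ioi 0)) :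
    ContDiffOn ℝ 2 (fun y : Eu N => H ‖y‖) {x | x ≠ 0} :=
  hH.comp (fun _ hx => (contDiffAt_norm ℝ hx).contDiffWithinAt) fun _ hx => norm_pos_iff.2 hx

lemma SolidHarmonic.fderiv_smul {j : ℕ} {P : Eu N → ℝ} (hP : SolidHarmonic j P) (hj : 1 ≤ j)
    {r : ℝ} (hr : 0 < r) (x : Eu N) :
    fderiv ℝ P (r • x) = r ^ (j - 1) • fderiv ℝ P x := by
  have hd : ∀ y, HasFDerivAt P (fderiv ℝ P y) y := fun y =>
    (hP.1.differentiable (by norm_num) y).hasFDerivAt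
  have h1 : HasFDerivAt (fun y => P (r • y))
      ((fderiv ℝ P (r • x)).comp (r • ContinuousLinearMap.id ℝ (Eu N))) x :=
    (hd (r • x)).comp x ((hasFDerivAt_id x).const_smul r)
  have h2 : HasFDerivAt (fun y => P (r • y)) (r ^ j • fderiv ℝ P x) x := by
    simp only [hP.2.1]
    exact (hd x).const_mul _
  ext v
  have h3 := congrArg (fun L : Eu N →L[ℝ] ℝ => L v) (h1.unique h2)
  simp at h3
  rw [← Nat.sub_add_cancel hj, pow_succ] at h3
  simp
  refine mul_left_cancel₀ hr.ne' (h3.trans ?_)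
  ring

lemma exists_bound_of_homogeneous {F : Type*} [NormedAddCommGroup F] [NormedSpace ℝ F] {j : ℕ}
    {f : Eu N → F} (hf : Continuous f) (hh : ∀ r > (0:ℝ), ∀ x, f (r • x) = r ^ j • f x) :
    ∃ M, 0 ≤ M ∧ ∀ x ≠ 0, ‖f x‖ ≤ M * ‖x‖ ^ j := by
  obtain ⟨M, hM⟩ := (isCompact_sphere (0 : Eu N) 1).exists_bound_of_continuousOn hf.continuousOn
  refine ⟨max M 0, le_max_right _ _, fun x hx => ?_⟩
  have hx' : 0 < ‖x‖ := norm_pos_iff.2 hx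
  have h1 : ‖x‖⁻¹ • x ∈ Metric.sphere (0 : Eu N) 1 := by
    simp [norm_smul, hx'.ne']
  have h2 : f x = ‖x‖ ^ j • f (‖x‖⁻¹ • x) := by
    rw [← hh _ hx', smul_inv_smul₀ hx'.ne']
  rw [h2, norm_smul, norm_pow, norm_norm, mul_comm]
  exact mul_le_mul_of_nonneg_right ((hM _ h1).trans (le_max_left _ _)) (by positivity)

lemma fderiv_radial_mul_skew {η f : Eu N → ℝ} {x : Eu N} {J : Eu N →L[ℝ] Eu N}
    (hη : DifferentiableAt ℝ η x) (hf : DifferentiableAt ℝ f x)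
    (h0 : fderiv ℝ η x (J x) = 0) :
    fderiv ℝ (fun y => η y * f y) x (J x) = η x * fderiv ℝ f x (J x) := by
  have h : fderiv ℝ (fun y => η y * f y) x = _ :=
    HasFDerivAt.fderiv (f := fun y => η y * f y) (hη.hasFDerivAt.mul hf.hasFDerivAt)
  rw [h]
  simp [h0]

lemma sphLap_radial_mul {H : ℝ → ℝ} (hH : ContDiffOn ℝ 2 H (Ioi 0)) {f : Eu N → ℝ}
    (hf : ContDiffOn ℝ 2 f {x | x ≠ 0}) {x : Eu N} (hx : x ≠ 0) :
    sphLap (fun y => H ‖y‖ * f y) x = H ‖x‖ * sphLap f x := by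
  have hd : ∀ y : Eu N, y ≠ 0 → DifferentiableAt ℝ (fun z : Eu N => H ‖z‖) y := fun y hy =>
    ((contDiffOn_comp_norm hH).differentiableOn (by norm_num)).differentiableAt
      (isOpen_ne.mem_nhds hy)
  have h0 : ∀ a b, ∀ y : Eu N, y ≠ 0 → fderiv ℝ (fun z : Eu N => H ‖z‖) y (rot a b y) = 0 :=
    fun a b y hy => by
      have hHd := ((hH.differentiableOn (by norm_num)).differentiableAt
        (Ioi_mem_nhds (norm_pos_iff.2 hy))).hasDerivAt
      rw [(hasFDerivAt_comp_norm hy hHd).fderiv]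
      have := inner_rot_self a b y
      rw [real_inner_comm] at this
      simp [this]
  rw [sphLap, sphLap, Finset.mul_sum]
  refine Finset.sum_congr rfl fun a _ => ?_
  rw [Finset.mul_sum]
  refine Finset.sum_congr rfl fun b _ => ?_
  have h1 : (fun y => fderiv ℝ (fun z => H ‖z‖ * f z) y (rot a b y)) =ᶠ[𝓝 x]
      fun y => H ‖y‖ * fderiv ℝ f y (rot a b y) := by
    filter_upwards [isOpen_ne.mem_nhds hx] with y hy
    exact fderiv_radial_mul_skew (hd y hy)
      ((hf.of_le (by norm_num)).hasFDerivAt_of_ne_zero hy).differentiableAt (h0 a b y hy)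
  rw [h1.fderiv_eq]
  exact fderiv_radial_mul_skew (hd x hx)
    ((hf.skew (J := rot a b)).hasFDerivAt_of_ne_zero hx).differentiableAt (h0 a b x hx)

/-- The function with radial profile `h` and angular part the solid harmonic `P`. -/
noncomputable def sepFun (j : ℕ) (h : ℝ → ℝ) (P : Eu N → ℝ) (x : Eu N) : ℝ :=
  h ‖x‖ * (‖x‖ ^ j)⁻¹ * P x

lemma contDiffOn_profile {h : ℝ → ℝ} (hh : ContDiffOn ℝ 2 h (Ioi 0)) (j : ℕ) :
    ContDiffOn ℝ 2 (fun r => h r * (r ^ j)⁻¹) (Ioi 0) :=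
  hh.mul ((contDiff_id.pow j).contDiffOn.inv fun _ hr => pow_ne_zero j (ne_of_gt hr))

lemma contDiffOn_sepFun {h : ℝ → ℝ} (hh : ContDiffOn ℝ 2 h (Ioi 0)) {j : ℕ} {P : Eu N → ℝ}
    (hP : SolidHarmonic j P) : ContDiffOn ℝ 2 (sepFun j h P) {x | x ≠ 0} :=
  (contDiffOn_comp_norm (contDiffOn_profile hh j)).mul hP.1.contDiffOn

lemma lap_sepFun {h : ℝ → ℝ} (hh : ContDiffOn ℝ 2 h (Ioi 0)) {j : ℕ} {P : Eu N → ℝ}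
    (hP : SolidHarmonic j P) {x : Eu N} (hx : x ≠ 0) :
    lap (sepFun j h P) x = (deriv (deriv h) ‖x‖ + (N - 1) / ‖x‖ * deriv h ‖x‖ -
      j * (j + N - 2) / ‖x‖ ^ 2 * h ‖x‖) * ((‖x‖ ^ j)⁻¹ * P x) := by
  have hx' : 0 < ‖x‖ := norm_pos_iff.2 hx
  have hd : ∀ r > 0, HasDerivAt h (deriv h r) r := fun r hr =>
    ((hh.differentiableOn (by norm_num)).differentiableAt (Ioi_mem_nhds hr)).hasDerivAt
  have hd2 : ∀ r > 0, HasDerivAt (deriv h) (deriv (deriv h) r) r := fun r hr =>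
    (((hh.deriv_of_isOpen isOpen_Ioi (m := 1) (by norm_num)).differentiableOn
      (by norm_num)).differentiableAt (Ioi_mem_nhds hr)).hasDerivAt
  have hlin : ∀ s : ℝ, HasDerivAt (fun s : ℝ => s * ‖x‖) ‖x‖ s := fun s => by
    simpa using (hasDerivAt_id s).mul_const ‖x‖
  obtain ⟨h1, h2⟩ := radial_fderiv_eq (contDiffOn_sepFun hh hP) hx
    (g := fun s => h (s * ‖x‖) * ((‖x‖ ^ j)⁻¹ * P x))
    (g' := fun s => deriv h (s * ‖x‖) * ‖x‖ * ((‖x‖ ^ j)⁻¹ * P x))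
    (g'' := deriv (deriv h) (1 * ‖x‖) * ‖x‖ * ‖x‖ * ((‖x‖ ^ j)⁻¹ * P x))
    (fun s hs => by
      rw [sepFun, norm_smul, Real.norm_of_nonneg hs.le, hP.2.1, mul_pow]
      field_simp)
    (fun s hs => ((hd _ (by positivity)).comp s (hlin s)).mul_const _)
    ((((hd2 _ (by positivity)).comp 1 (hlin 1)).mul_const _).mul_const _)
  have h3 := norm_sq_mul_lap (contDiffOn_sepFun hh hP) hx
  have h4 : sphLap (sepFun j h P) x = _ :=
    sphLap_radial_mul (contDiffOn_profile hh j) hP.1.contDiffOn hx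
  rw [h1, h2, h4, hP.sphLap_eq hx, one_mul] at h3
  have h5 : lap (sepFun j h P) x = ‖x‖ ^ 2 * lap (sepFun j h P) x / ‖x‖ ^ 2 := by
    field_simp
  rw [h5, h3]
  field_simp
  ring

lemma norm_fderiv_sepFun_le {h : ℝ → ℝ} (hh : ContDiffOn ℝ 2 h (Ioi 0)) {j : ℕ} {P : Eu N → ℝ}
    (hP : SolidHarmonic j P) (hj : 1 ≤ j) :
    ∃ C, ∀ x ≠ 0, ‖fderiv ℝ (sepFun j h P) x‖ ^ 2 ≤
      C * (deriv h ‖x‖ ^ 2 + (h ‖x‖ / ‖x‖) ^ 2) := by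
  obtain ⟨M, hM0, hM⟩ := exists_bound_of_homogeneous (j := j) hP.1.continuous
    fun r _ x => hP.2.1 r x
  obtain ⟨M', hM0', hM'⟩ := exists_bound_of_homogeneous (j := j - 1)
    (hP.1.continuous_fderiv (by norm_num)) fun r hr x => hP.fderiv_smul hj hr x
  refine ⟨2 * (M ^ 2 + (j * M + M') ^ 2), fun x hx => ?_⟩
  have hx' : 0 < ‖x‖ := norm_pos_iff.2 hx
  have hd : HasDerivAt h (deriv h ‖x‖) ‖x‖ :=
    ((hh.differentiableOn (by norm_num)).differentiableAt (Ioi_mem_nhds hx')).hasDerivAt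
  have hH : HasDerivAt (fun r => h r * (r ^ j)⁻¹)
      (deriv h ‖x‖ * (‖x‖ ^ j)⁻¹ - j * (h ‖x‖ / ‖x‖) * (‖x‖ ^ j)⁻¹) ‖x‖ := by
    have := hd.mul ((hasDerivAt_pow j ‖x‖).inv (pow_ne_zero j hx'.ne'))
    refine HasDerivAt.congr_deriv this ?_
    obtain ⟨i, rfl⟩ := Nat.exists_eq_add_of_le' hj
    simp only [Nat.add_sub_cancel, Pi.inv_apply]
    field_simp
    ring
  have hD : HasFDerivAt (sepFun j h P) _ x :=
    (hasFDerivAt_comp_norm hx hH).mul (hP.1.differentiable (by norm_num) x).hasFDerivAt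
  have hn : ‖‖x‖⁻¹ • innerSL ℝ x‖ = 1 := by
    rw [norm_smul, innerSL_apply_norm, norm_inv, norm_norm, inv_mul_cancel₀ hx'.ne']
  have h1 : ‖fderiv ℝ (sepFun j h P) x‖ ≤
      |deriv h ‖x‖| * M + |h ‖x‖ / ‖x‖| * (j * M + M') := by
    rw [hD.fderiv]
    refine (norm_add_le _ _).trans ?_
    rw [norm_smul, norm_smul, norm_smul _ (‖x‖⁻¹ • innerSL ℝ x), hn, mul_one, ← sub_mul,
      norm_mul, norm_mul, norm_inv, norm_pow, norm_norm]
    have h2 : ‖fderiv ℝ P x‖ * (‖x‖ ^ j)⁻¹ ≤ M' / ‖x‖ := by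
      rw [← div_eq_mul_inv, div_le_div_iff₀ (by positivity) hx']
      calc ‖fderiv ℝ P x‖ * ‖x‖ ≤ M' * ‖x‖ ^ (j - 1) * ‖x‖ :=
            mul_le_mul_of_nonneg_right (hM' x hx) hx'.le
        _ = M' * ‖x‖ ^ j := by rw [mul_assoc, ← pow_succ, Nat.sub_add_cancel hj]
    have h3 : ‖P x‖ * (‖x‖ ^ j)⁻¹ ≤ M := by
      rw [← div_eq_mul_inv, div_le_iff₀ (by positivity)]
      exact hM x hx
    have h4 : ‖deriv h ‖x‖ - j * (h ‖x‖ / ‖x‖)‖ ≤ |deriv h ‖x‖| + j * |h ‖x‖ / ‖x‖| := by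
      refine (norm_sub_le _ _).trans ?_
      rw [norm_mul, Real.norm_natCast]
      rfl
    have h5 : ‖h ‖x‖‖ * (M' / ‖x‖) = |h ‖x‖ / ‖x‖| * M' := by
      rw [abs_div, abs_of_pos hx', Real.norm_eq_abs]
      ring
    have h6 := mul_le_mul_of_nonneg_left h2 (norm_nonneg (h ‖x‖))
    have h7 := mul_le_mul h4 h3 (by positivity) (by positivity)
    rw [h5] at h6
    linarith
  have h2 : ‖fderiv ℝ (sepFun j h P) x‖ ^ 2 ≤
      (|deriv h ‖x‖| * M + |h ‖x‖ / ‖x‖| * (j * M + M')) ^ 2 :=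
    pow_le_pow_left₀ (norm_nonneg _) h1 2
  rw [← sq_abs (deriv h ‖x‖), ← sq_abs (h ‖x‖ / ‖x‖)]
  nlinarith [sq_nonneg (|deriv h ‖x‖| * M - |h ‖x‖ / ‖x‖| * (j * M + M')),
    sq_nonneg (|deriv h ‖x‖| * (j * M + M')), sq_nonneg (|h ‖x‖ / ‖x‖| * M)]

end Existence

section ExistenceSolution

variable {N : ℕ} {α : ℝ}

lemma integrable_of_le_radial (hN : 1 ≤ N) {f : Eu N → ℝ} {g : ℝ → ℝ}
    (hf : ContinuousOn f {x | x ≠ 0}) (hg : IntegrableOn (fun r => r ^ (N - 1) * g r) (Ioi 0))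
    (hfg : ∀ x ≠ 0, |f x| ≤ g ‖x‖) : Integrable f := by
  have : Nonempty (Fin N) := ⟨⟨0, hN⟩⟩
  have h1 : Integrable fun x : Eu N => g ‖x‖ := by
    rw [integrable_fun_norm_addHaar, finrank_euclideanSpace_fin]
    exact hg
  rw [← integrableOn_univ, ← integrableOn_congr_set_ae (s := {x : Eu N | x ≠ 0})
    (by rw [ae_eq_univ]; simp [compl_ofPred])]
  refine Integrable.mono' h1.integrableOn (hf.aestronglyMeasurable isOpen_ne.measurableSet) ?_
  filter_upwards [ae_restrict_mem isOpen_ne.measurableSet] with x hx using hfg x hx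

/-- Solutions of the singular Emden–Fowler equation give solutions of the linearized problem with
separated variables. -/
lemma SingSol.linSolution {A χ : ℝ → ℝ} {P : Eu N → ℝ} {j : ℕ} (hN : 3 ≤ N) (hα : 0 < α)
    (hj : 1 ≤ j) (hχ : SingSol (kk N α) A (4 * (j * (j + N - 2)) / (2 + α) ^ 2) χ)
    (hP : SolidHarmonic j P) :
    LinSolution N α (fun x => A (emden α ‖x‖)) (sepFun j (fun r => χ (emden α r)) P) := by
  have hN1 : 1 ≤ N := by omega
  obtain ⟨hχ2, hχE, hχeq⟩ := hχ
  set h : ℝ → ℝ := fun r => χ (emden α r) with hh_def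
  have hh : ContDiffOn ℝ 2 h (Ioi 0) :=
    hχ2.comp (contDiffOn_emden α) fun r hr => emden_pos hα hr
  have hdh : ∀ r > 0, deriv h r = deriv χ (emden α r) * r ^ (α / 2) := fun r hr =>
    ((hχE.hasDerivAt (emden_pos hα hr)).comp r (hasDerivAt_emden hα hr)).deriv
  have hb := contDiffOn_sepFun hh hP
  obtain ⟨M, hM0, hM⟩ := exists_bound_of_homogeneous (j := j) hP.1.continuous
    fun r _ x => hP.2.1 r x
  obtain ⟨C, hC⟩ := norm_fderiv_sepFun_le hh hP hj
  refine ⟨hb, fun x hx => ?_, ?_, ?_⟩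
  · have hr : 0 < ‖x‖ := norm_pos_iff.2 hx
    have ht := emden_pos hα hr
    have hop := emden_operator (N := N) hα hh (j * (j + N - 2)) ht
    have hev : (fun t => h (emdenInv α t)) =ᶠ[𝓝 (emden α ‖x‖)] χ := by
      filter_upwards [Ioi_mem_nhds ht] with t ht using by
        simp only [hh_def, emden_emdenInv hα ht]
    rw [hev.deriv.deriv_eq, hev.deriv_eq, hev.eq_of_nhds, hχeq _ ht, emdenInv_emden hα hr] at hop
    rw [lap_sepFun hh hP hx, sepFun]
    have h1 : ‖x‖ ^ (-α) = (‖x‖ ^ α)⁻¹ := Real.rpow_neg hr.le α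
    have h2 : ‖x‖ ^ α ≠ 0 := (Real.rpow_pos_of_pos hr α).ne'
    have h3 : -(deriv (deriv h) ‖x‖ + (N - 1) / ‖x‖ * deriv h ‖x‖ -
        j * (j + N - 2) / ‖x‖ ^ 2 * h ‖x‖) =
        ‖x‖ ^ α * (A (emden α ‖x‖) * χ (emden α ‖x‖)) := by
      have h4 : h ‖x‖ = χ (emden α ‖x‖) := rfl
      rw [h4]
      rw [hop, h1]
      field_simp
    rw [← neg_mul, h3]
    ring
  · refine integrable_of_le_radial hN1 (g := fun r => M ^ 2 * (r ^ α * h r ^ 2)) ?_ ?_ ?_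
    · exact (continuousOn_id.norm.rpow_const fun x hx => Or.inl (norm_ne_zero_iff.2 hx)).mul
        (hb.continuousOn.pow 2)
    · have h1 := ((integrableOn_emden_iff hα _ _).1 hχE.integrableOn_sq).const_mul (M ^ 2)
      refine IntegrableOn.congr_fun h1 (fun r hr => ?_) measurableSet_Ioi
      have hr : 0 < r := hr
      rw [kk_weight hα, Real.rpow_add hr, rpow_natCast_sub_one hN1]
      ring
    · intro x hx
      have hr : 0 < ‖x‖ := norm_pos_iff.2 hx
      have h1 : |sepFun j h P x| ≤ |h ‖x‖| * M := by
        rw [sepFun, mul_assoc, abs_mul]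
        refine mul_le_mul_of_nonneg_left ?_ (abs_nonneg _)
        rw [abs_mul, abs_of_pos (by positivity : 0 < (‖x‖ ^ j)⁻¹), ← div_eq_inv_mul,
          div_le_iff₀ (by positivity)]
        exact hM x hx
      have h2 := pow_le_pow_left₀ (abs_nonneg _) h1 2
      rw [sq_abs, mul_pow, sq_abs] at h2
      rw [abs_of_nonneg (by positivity)]
      have h3 := mul_le_mul_of_nonneg_left h2 (Real.rpow_nonneg hr.le α)
      linarith
  · refine integrable_of_le_radial hN1
      (g := fun r => C * (deriv h r ^ 2 + (h r / r) ^ 2)) ?_ ?_ fun x hx => ?_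
    · exact (hb.of_le (by norm_num)).continuousOn_fderiv_ne_zero.norm.pow 2
    · have h1 := (integrableOn_emden_iff hα _ _).1 hχE.integrableOn_deriv_sq
      have h2 := (integrableOn_emden_iff hα _ _).1
        (memE.integrableOn_hardy (one_lt_kk hN hα) hχE)
      refine IntegrableOn.congr_fun ((h1.add h2).const_mul C) (fun r hr => ?_) measurableSet_Ioi
      have hr : 0 < r := hr
      have he : (2 + α) / 2 * (kk N α - 2) + α / 2 = (N - 1) + -2 := by
        rw [mul_sub, sub_add_eq_add_sub, kk_weight hα]
        ring
      simp only [Pi.add_apply]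
      rw [he, kk_weight hα, Real.rpow_add hr, Real.rpow_add hr, rpow_natCast_sub_one hN1, hdh r hr,
        mul_pow, ← Real.rpow_mul_natCast hr.le, show α / 2 * (2:ℕ) = α by push_cast; ring,
        Real.rpow_neg hr.le, Real.rpow_two]
      ring
    · rw [abs_of_nonneg (by positivity)]
      exact hC x hx

end ExistenceSolution

section HarmonicPolynomials

open MvPolynomial

variable {N : ℕ}

/-- The polynomial function on Euclidean space defined by a polynomial. -/
noncomputable def polyFun (p : MvPolynomial (Fin N) ℝ) (x : Eu N) : ℝ :=
  eval (fun i => x i) p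

lemma hasFDerivAt_coord (i : Fin N) (x : Eu N) :
    HasFDerivAt (fun y : Eu N => y i) (EuclideanSpace.proj i : Eu N →L[ℝ] ℝ) x :=
  (EuclideanSpace.proj i : Eu N →L[ℝ] ℝ).hasFDerivAt

lemma contDiff_polyFun (p : MvPolynomial (Fin N) ℝ) : ContDiff ℝ 2 (polyFun p) := by
  unfold polyFun
  induction p using MvPolynomial.induction_on with
  | C a => simpa using contDiff_const
  | add p q hp hq => simpa using hp.add hq
  | mul_X p i hp =>
    simpa using hp.mul (EuclideanSpace.proj i : Eu N →L[ℝ] ℝ).contDiff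

lemma fderiv_polyFun (p : MvPolynomial (Fin N) ℝ) (x : Eu N) (i : Fin N) :
    fderiv ℝ (polyFun p) x (EuclideanSpace.single i 1) = polyFun (pderiv i p) x := by
  have hd : ∀ q : MvPolynomial (Fin N) ℝ, DifferentiableAt ℝ (polyFun q) x := fun q =>
    ((contDiff_polyFun q).differentiable (by norm_num)).differentiableAt
  induction p using MvPolynomial.induction_on with
  | C a =>
    have : polyFun (C a : MvPolynomial (Fin N) ℝ) = fun _ => a := by ext; simp [polyFun]
    rw [this]
    simp [polyFun]
  | add p q hp hq =>
    have : polyFun (p + q) = polyFun p + polyFun q := by ext; simp [polyFun]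
    rw [this, fderiv_add (hd p) (hd q)]
    simp [hp, hq, polyFun]
  | mul_X p j hp =>
    have : polyFun (p * X j) = fun y => polyFun p y * y j := by ext; simp [polyFun]
    rw [this, fderiv_fun_mul (hd p) (hasFDerivAt_coord j x).differentiableAt,
      (hasFDerivAt_coord j x).fderiv]
    by_cases h : i = j
    · subst h
      simp [hp, polyFun, Derivation.leibniz]
    · simp [hp, polyFun, Derivation.leibniz, pderiv_X, Ne.symm h]

/-- The Laplacian on polynomials. -/
noncomputable def polyLap (N : ℕ) : MvPolynomial (Fin N) ℝ →ₗ[ℝ] MvPolynomial (Fin N) ℝ :=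
  ∑ i, (pderiv i).toLinearMap ∘ₗ (pderiv i).toLinearMap

lemma lap_polyFun (p : MvPolynomial (Fin N) ℝ) (x : Eu N) :
    lap (polyFun p) x = polyFun (polyLap N p) x := by
  simp only [lap, fderiv_polyFun]
  simp [polyLap, polyFun]

/-- The polynomial `‖x‖²`. -/
noncomputable def normSqPoly (N : ℕ) : MvPolynomial (Fin N) ℝ := ∑ i, X i ^ 2

lemma polyFun_normSqPoly (x : Eu N) : polyFun (normSqPoly N) x = ‖x‖ ^ 2 := by
  simp [polyFun, normSqPoly, EuclideanSpace.norm_sq_eq]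

lemma polyFun_smul_of_isHomogeneous {p : MvPolynomial (Fin N) ℝ} {j : ℕ} (hp : p.IsHomogeneous j)
    (r : ℝ) (x : Eu N) : polyFun p (r • x) = r ^ j * polyFun p x := by
  unfold polyFun
  rw [eval_eq, eval_eq, Finset.mul_sum]
  refine Finset.sum_congr rfl fun d hd => ?_
  have h1 : ∏ i ∈ d.support, r ^ d i = r ^ j := by
    rw [Finset.prod_pow_eq_pow_sum, ← hp.degree_eq_sum_deg_support hd]
  simp only [PiLp.smul_apply, smul_eq_mul, mul_pow, Finset.prod_mul_distrib, h1]
  ring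

lemma isHomogeneous_polyLap {p : MvPolynomial (Fin N) ℝ} {j : ℕ} (hp : p.IsHomogeneous j) :
    (polyLap N p).IsHomogeneous (j - 2) := by
  simp only [polyLap, LinearMap.coe_sum, Finset.sum_apply]
  exact IsHomogeneous.sum _ _ _ fun i _ => hp.pderiv.pderiv

lemma polyLap_eq_zero_of_lt {p : MvPolynomial (Fin N) ℝ} {j : ℕ} (hp : p.IsHomogeneous j)
    (hj : j < 2) : polyLap N p = 0 := by
  simp only [polyLap, LinearMap.coe_sum, Finset.sum_apply]
  refine Finset.sum_eq_zero fun i _ => ?_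
  have h : (pderiv i p).IsHomogeneous 0 := by
    have := hp.pderiv (i := i)
    rwa [show j - 1 = 0 by omega] at this
  rw [← totalDegree_zero_iff_isHomogeneous, totalDegree_eq_zero_iff_eq_C] at h
  rw [LinearMap.comp_apply]
  change pderiv i (pderiv i p) = 0
  rw [h, pderiv_C]

lemma isHomogeneous_normSqPoly_mul {p : MvPolynomial (Fin N) ℝ} {j : ℕ}
    (hp : p.IsHomogeneous j) : (normSqPoly N * p).IsHomogeneous (j + 2) := by
  rw [add_comm]
  exact (IsHomogeneous.sum _ _ _ fun i _ => isHomogeneous_X_pow i 2).mul hp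

lemma solidHarmonic_polyFun {p : MvPolynomial (Fin N) ℝ} {j : ℕ} (hp : p.IsHomogeneous j)
    (hl : polyLap N p = 0) : SolidHarmonic j (polyFun p) :=
  ⟨contDiff_polyFun p, polyFun_smul_of_isHomogeneous hp, fun x => by
    simp [lap_polyFun, hl, polyFun]⟩

lemma eq_zero_of_polyFun_sphere {p : MvPolynomial (Fin N) ℝ} {j : ℕ} (hp : p.IsHomogeneous j)
    (hN : 1 ≤ N) (h : ∀ θ : Sph N, polyFun p θ = 0) : p = 0 := by
  have hne : ∀ x : Eu N, x ≠ 0 → polyFun p x = 0 := fun x hx => by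
    have hx' : ‖x‖ ≠ 0 := norm_ne_zero_iff.2 hx
    have := polyFun_smul_of_isHomogeneous hp ‖x‖ (‖x‖⁻¹ • x)
    rw [smul_inv_smul₀ hx'] at this
    rw [this, h ⟨‖x‖⁻¹ • x, by simp [norm_smul, hx']⟩, mul_zero]
  have hall : ∀ x : Eu N, polyFun p x = 0 := fun x => by
    have : Nonempty (Fin N) := ⟨⟨0, hN⟩⟩
    have hd : Dense ({0}ᶜ : Set (Eu N)) := dense_compl_singleton 0
    exact congrFun ((contDiff_polyFun p).continuous.ext_on hd continuous_const
      fun y hy => hne y hy) x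
  refine MvPolynomial.funext fun x => ?_
  simpa [polyFun] using hall (WithLp.toLp 2 x)

lemma SolidHarmonic.orthogonal {P Q : Eu N → ℝ} {j l : ℕ} (hP : SolidHarmonic j P)
    (hQ : SolidHarmonic l Q) (hN : 2 ≤ N) (hjl : j ≠ l) :
    ∫ θ : Sph N, P θ * Q θ ∂sphMeas N = 0 := by
  have h := integral_toSphere_sphLap_mul hP.1.contDiffOn hQ.1.contDiffOn one_pos
  have h0 : ∀ θ : Sph N, (θ : Eu N) ≠ 0 := fun θ => by
    simpa using smul_sphere_ne_zero one_pos θ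
  simp only [one_smul, hP.sphLap_eq (h0 _), hQ.sphLap_eq (h0 _), mul_assoc,
    mul_left_comm (P _), integral_const_mul] at h
  have h1 : ((j:ℝ) - l) * (j + l + N - 2) * ∫ θ : Sph N, P θ * Q θ ∂sphMeas N = 0 := by
    linear_combination -(1 / 2) * h
  refine (mul_eq_zero.1 h1).resolve_left (mul_ne_zero (sub_ne_zero.2 (by exact_mod_cast hjl)) ?_)
  have : (1:ℝ) ≤ j + l := by
    have : 1 ≤ j + l := by omega
    exact_mod_cast this
  have : (2:ℝ) ≤ N := by exact_mod_cast hN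
  linarith

end HarmonicPolynomials

section HarmonicDecomposition

open MvPolynomial

variable {N : ℕ}

/-- The homogeneous harmonic polynomials of degree `j`. -/
noncomputable def harmPoly (N j : ℕ) : Submodule ℝ (MvPolynomial (Fin N) ℝ) :=
  homogeneousSubmodule (Fin N) ℝ j ⊓ LinearMap.ker (polyLap N)

lemma solidHarmonic_of_mem_harmPoly {j : ℕ} {p : MvPolynomial (Fin N) ℝ}
    (hp : p ∈ harmPoly N j) : SolidHarmonic j (polyFun p) :=
  solidHarmonic_polyFun hp.1 hp.2

instance (j : ℕ) : FiniteDimensional ℝ (homogeneousSubmodule (Fin N) ℝ j) :=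
  Module.Finite.iff_fg.2 (homogeneousSubmodule_fg (Fin N) ℝ j)

instance (j : ℕ) : FiniteDimensional ℝ (harmPoly N j) :=
  Submodule.finiteDimensional_inf_left _ _

lemma polyFun_add (p q : MvPolynomial (Fin N) ℝ) (x : Eu N) :
    polyFun (p + q) x = polyFun p x + polyFun q x := by
  simp [polyFun]

lemma polyFun_normSqPoly_mul (q : MvPolynomial (Fin N) ℝ) (θ : Sph N) :
    polyFun (normSqPoly N * q) θ = polyFun q θ := by
  have h : polyFun (normSqPoly N * q) θ = polyFun (normSqPoly N) θ * polyFun q θ := by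
    simp [polyFun]
  rw [h, polyFun_normSqPoly, norm_eq_of_mem_sphere, one_pow, one_mul]

lemma eq_zero_of_integral_sq_sphere {f : Sph N → ℝ} (hf : Continuous f)
    (h : ∫ θ, f θ ^ 2 ∂sphMeas N = 0) (θ : Sph N) : f θ = 0 := by
  by_contra hθ
  have := (hf.pow 2).integral_pos_of_hasCompactSupport_nonneg_nonzero (μ := sphMeas N)
    (HasCompactSupport.of_compactSpace _) (fun _ => sq_nonneg _) (x := θ) (pow_ne_zero 2 hθ)
  exact this.ne' h

lemma continuous_polyFun_sphere (p : MvPolynomial (Fin N) ℝ) :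
    Continuous fun θ : Sph N => polyFun p θ :=
  (contDiff_polyFun p).continuous.comp continuous_subtype_val

lemma integrable_sphere {f : Sph N → ℝ} (hf : Continuous f) : Integrable f (sphMeas N) :=
  hf.integrable_of_hasCompactSupport (HasCompactSupport.of_compactSpace _)

lemma integrable_mul_polyFun {g : Sph N → ℝ} (hg : Continuous g) (p : MvPolynomial (Fin N) ℝ) :
    Integrable (fun θ : Sph N => g θ * polyFun p θ) (sphMeas N) :=
  integrable_sphere (hg.mul (continuous_polyFun_sphere p))

lemma integral_mul_polyFun_add {g : Sph N → ℝ} (hg : Continuous g) (p q : MvPolynomial (Fin N) ℝ) :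
    ∫ θ, g θ * polyFun (p + q) θ ∂sphMeas N =
      ∫ θ, g θ * polyFun p θ ∂sphMeas N + ∫ θ, g θ * polyFun q θ ∂sphMeas N := by
  simp only [polyFun_add, mul_add]
  exact integral_add (integrable_mul_polyFun hg p) (integrable_mul_polyFun hg q)

/-- Functions on the sphere that are orthogonal to the spherical harmonics of degree at most `j`
are orthogonal to the homogeneous polynomials of degree `j`. -/
def OrthogonalToHomogeneous (N j : ℕ) : Prop :=
  ∀ g : Sph N → ℝ, Continuous g →
    (∀ l ≤ j, ∀ p ∈ harmPoly N l, ∫ θ, g θ * polyFun p θ ∂sphMeas N = 0) →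
    ∀ p : MvPolynomial (Fin N) ℝ, p.IsHomogeneous j → ∫ θ, g θ * polyFun p θ ∂sphMeas N = 0

lemma OrthogonalToHomogeneous.eq_zero (hN : 2 ≤ N) {j : ℕ} (hj : OrthogonalToHomogeneous N j)
    {q : MvPolynomial (Fin N) ℝ} (hq : q.IsHomogeneous j)
    (hl : polyLap N (normSqPoly N * q) = 0) : q = 0 := by
  have hH := solidHarmonic_polyFun (isHomogeneous_normSqPoly_mul hq) hl
  have h := hj _ (continuous_polyFun_sphere (normSqPoly N * q)) (fun l hlj p hp =>
    hH.orthogonal (solidHarmonic_of_mem_harmPoly hp) hN (by omega)) q hq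
  simp only [polyFun_normSqPoly_mul, ← pow_two] at h
  exact eq_zero_of_polyFun_sphere hq (by omega)
    (eq_zero_of_integral_sq_sphere (continuous_polyFun_sphere q) h)

lemma OrthogonalToHomogeneous.exists_polyLap_eq (hN : 2 ≤ N) {j : ℕ}
    (hj : OrthogonalToHomogeneous N j) {p : MvPolynomial (Fin N) ℝ} (hp : p.IsHomogeneous j) :
    ∃ q : MvPolynomial (Fin N) ℝ, q.IsHomogeneous j ∧ polyLap N (normSqPoly N * q) = p := by
  set T : homogeneousSubmodule (Fin N) ℝ j →ₗ[ℝ] homogeneousSubmodule (Fin N) ℝ j :=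
    (polyLap N ∘ₗ LinearMap.mulLeft ℝ (normSqPoly N)).restrict
      fun q hq => by simpa using isHomogeneous_polyLap (isHomogeneous_normSqPoly_mul hq) with hT
  have hTinj : Function.Injective T := by
    rw [injective_iff_map_eq_zero]
    intro q hq
    exact Subtype.ext (hj.eq_zero hN q.2 (congrArg Subtype.val hq))
  obtain ⟨q, hq⟩ := LinearMap.injective_iff_surjective.1 hTinj ⟨p, hp⟩
  exact ⟨q, q.2, congrArg Subtype.val hq⟩

lemma orthogonalToHomogeneous (hN : 2 ≤ N) (j : ℕ) : OrthogonalToHomogeneous N j := by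
  induction j using Nat.strong_induction_on with
  | _ j ih =>
    intro g hg h p hp
    rcases lt_or_ge j 2 with hj | hj
    · exact h j le_rfl p ⟨hp, polyLap_eq_zero_of_lt hp hj⟩
    · obtain ⟨j, rfl⟩ := Nat.exists_eq_add_of_le' hj
      have hO := ih j (by omega)
      obtain ⟨q, hq, hql⟩ := hO.exists_polyLap_eq hN (isHomogeneous_polyLap hp)
      have hH : p - normSqPoly N * q ∈ harmPoly N (j + 2) :=
        ⟨hp.sub (isHomogeneous_normSqPoly_mul hq), by simp [hql]⟩
      have h1 := h (j + 2) le_rfl _ hH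
      have h2 := hO g hg (fun l hl => h l (by omega)) q hq
      have h3 := integral_mul_polyFun_add hg (p - normSqPoly N * q) (normSqPoly N * q)
      simp only [sub_add_cancel, polyFun_normSqPoly_mul] at h3
      rw [h3, h1, h2, add_zero]

/-- Spherical harmonics are complete. -/
lemma eq_zero_of_orthogonal_harmPoly (hN : 2 ≤ N) {g : Sph N → ℝ} (hg : Continuous g)
    (h : ∀ l, ∀ p ∈ harmPoly N l, ∫ θ, g θ * polyFun p θ ∂sphMeas N = 0) (θ : Sph N) :
    g θ = 0 := by
  have hpoly : ∀ p : MvPolynomial (Fin N) ℝ, ∫ θ, g θ * polyFun p θ ∂sphMeas N = 0 := fun p => by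
    have h1 : ∀ θ : Sph N, g θ * polyFun p θ =
        ∑ j ∈ Finset.range (p.totalDegree + 1), g θ * polyFun (homogeneousComponent j p) θ :=
      fun θ => by
        conv_lhs => rw [← sum_homogeneousComponent p]
        simp [polyFun, Finset.mul_sum]
    simp only [h1]
    rw [integral_finsetSum _ fun j _ => integrable_mul_polyFun hg _]
    exact Finset.sum_eq_zero fun j _ => orthogonalToHomogeneous hN j g hg (fun l _ => h l) _
      (homogeneousComponent_isHomogeneous j p)
  refine eq_zero_of_integral_sq_sphere hg ?_ θ
  set X : Fin N → C(Sph N, ℝ) := fun i => ⟨fun θ => (θ : Eu N) i, by fun_prop⟩ with hX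
  set Φ : MvPolynomial (Fin N) ℝ →ₐ[ℝ] C(Sph N, ℝ) := aeval X with hΦ
  have hXp : ∀ (p : MvPolynomial (Fin N) ℝ) (θ : Sph N), Φ p θ = polyFun p θ := fun p θ => by
    induction p using MvPolynomial.induction_on with
    | C a => simp [polyFun]
    | add p q hp hq => simp [polyFun_add, hp, hq]
    | mul_X p i hp =>
      rw [map_mul, ContinuousMap.mul_apply, hp, hΦ, aeval_X]
      simp [polyFun, hX]
  have hsep : Φ.range.SeparatesPoints := by
    intro θ φ hne
    obtain ⟨i, hi⟩ : ∃ i, (θ : Eu N) i ≠ (φ : Eu N) i := by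
      by_contra! hcon
      exact hne (Subtype.ext (PiLp.ext hcon))
    exact ⟨X i, ⟨X i, ⟨MvPolynomial.X i, by simp [hΦ]⟩, rfl⟩, hi⟩
  have hcont : Continuous fun f : C(Sph N, ℝ) => ∫ θ, g θ * f θ ∂sphMeas N := by
    have h1 : Continuous fun f : C(Sph N, ℝ) =>
        ∫ θ, ContinuousMap.toLp 1 (sphMeas N) ℝ ((⟨g, hg⟩ : C(Sph N, ℝ)) * f) θ ∂sphMeas N :=
      continuous_integral.comp ((ContinuousMap.toLp 1 (sphMeas N) ℝ).continuous.comp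
        (continuous_const.mul continuous_id))
    convert h1 using 2 with f
    refine integral_congr_ae ?_
    filter_upwards [ContinuousMap.coeFn_toLp (p := 1) (𝕜 := ℝ) (sphMeas N)
      ((⟨g, hg⟩ : C(Sph N, ℝ)) * f)] with θ hθ
    rw [hθ]
    rfl
  have hclosed : IsClosed {f : C(Sph N, ℝ) | ∫ θ, g θ * f θ ∂sphMeas N = 0} :=
    isClosed_eq hcont continuous_const
  have hmem : (⟨g, hg⟩ : C(Sph N, ℝ)) ∈ Φ.range.topologicalClosure := by
    rw [ContinuousMap.subalgebra_topologicalClosure_eq_top_of_separatesPoints _ hsep]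
    trivial
  have hg0 := closure_minimal (s := (Φ.range : Set C(Sph N, ℝ))) (fun f hf => by
    obtain ⟨p, rfl⟩ := hf
    simpa [hXp] using hpoly p) hclosed hmem
  simpa [pow_two] using hg0

lemma finrank_homogeneousSubmodule (N j : ℕ) :
    Module.finrank ℝ (homogeneousSubmodule (Fin N) ℝ j) = N.multichoose j := by
  have h0 := Finset.card_finsuppAntidiag_nat_eq_multichoose (s := (Finset.univ : Finset (Fin N))) j
  rw [Finset.card_univ, Fintype.card_fin] at h0
  rw [← h0]
  have h1 : {d : Fin N →₀ ℕ | Finsupp.degree d = j} =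
      ((Finset.univ.finsuppAntidiag j : Finset (Fin N →₀ ℕ)) : Set (Fin N →₀ ℕ)) := by
    ext d
    simp [Finsupp.degree_eq_sum]
  rw [homogeneousSubmodule_eq_finsupp_supported, AddMonoidAlgebra.supported_eq_span_single, h1]
  rw [Set.image_eq_range, finrank_span_eq_card]
  · simp
  · exact (basisMonomials (Fin N) ℝ).linearIndependent.comp _ Subtype.val_injective

lemma finrank_harmPoly_add (hN : 2 ≤ N) (j : ℕ) :
    Module.finrank ℝ (harmPoly N (j + 2)) + N.multichoose j = N.multichoose (j + 2) := by
  set L : homogeneousSubmodule (Fin N) ℝ (j + 2) →ₗ[ℝ] homogeneousSubmodule (Fin N) ℝ j :=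
    (polyLap N).restrict fun q hq => by simpa using isHomogeneous_polyLap hq with hL
  have hsurj : Function.Surjective L := fun p => by
    obtain ⟨q, hq, hqp⟩ := (orthogonalToHomogeneous hN j).exists_polyLap_eq hN p.2
    exact ⟨⟨_, isHomogeneous_normSqPoly_mul hq⟩, Subtype.ext hqp⟩
  have h := L.finrank_range_add_finrank_ker
  rw [LinearMap.range_eq_top.2 hsurj, finrank_top, finrank_homogeneousSubmodule,
    finrank_homogeneousSubmodule] at h
  have hker : Module.finrank ℝ (LinearMap.ker L) = Module.finrank ℝ (harmPoly N (j + 2)) := by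
    have hr : LinearMap.range ((Submodule.subtype _) ∘ₗ (LinearMap.ker L).subtype) =
        harmPoly N (j + 2) := by
      ext p
      constructor
      · rintro ⟨q, rfl⟩
        exact ⟨q.1.2, congrArg Subtype.val q.2⟩
      · exact fun hp => ⟨⟨⟨p, hp.1⟩, Subtype.ext hp.2⟩, rfl⟩
    rw [← hr, LinearMap.finrank_range_of_inj (Subtype.val_injective.comp Subtype.val_injective)]
  rw [← h, hker, add_comm]

lemma finrank_harmPoly_mul (hN : 2 ≤ N) {i : ℕ} (hi : 0 < i) :
    Module.finrank ℝ (harmPoly N (i + 1)) * ((N - 2).factorial * (i + 1).factorial) =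
      (N + 2 * i) * (N + i - 2).factorial := by
  obtain ⟨i, rfl⟩ := Nat.exists_eq_add_of_le' hi
  obtain ⟨n, rfl⟩ := Nat.exists_eq_add_of_le' hN
  have h := finrank_harmPoly_add hN i
  rw [Nat.multichoose_eq, Nat.multichoose_eq] at h
  set d := Module.finrank ℝ (harmPoly (n + 2) (i + 2))
  have ha := Nat.add_choose_mul_factorial_mul_factorial i (n + 1)
  have hA := Nat.add_choose_mul_factorial_mul_factorial (i + 2) (n + 1)
  rw [show n + 2 + i - 1 = i + (n + 1) by omega,
    show n + 2 + (i + 2) - 1 = i + 2 + (n + 1) by omega, Nat.choose_symm_add, Nat.choose_symm_add] at h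
  rw [show n + 2 + (i + 1) - 2 = n + i + 1 by omega, show n + 2 - 2 = n by omega]
  rw [← h] at hA
  rw [show i + 2 + (n + 1) = n + i + 1 + 1 + 1 by ring] at hA
  rw [show i + (n + 1) = n + i + 1 by ring] at ha hA
  simp only [Nat.factorial_succ (n + i + 1), Nat.factorial_succ (n + i + 1 + 1),
    Nat.factorial_succ n, Nat.factorial_succ i, Nat.factorial_succ (i + 1)] at *
  refine Nat.eq_of_mul_eq_mul_left (Nat.succ_pos n) ?_
  zify at ha hA ⊢
  linear_combination hA - (i + 1) * (i + 2) * ha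

lemma finrank_harmPoly (hN : 2 ≤ N) {i : ℕ} (hi : 0 < i) :
    Module.finrank ℝ (harmPoly N (i + 1)) = dimN N i :=
  (Nat.div_eq_of_eq_mul_left (by positivity) (finrank_harmPoly_mul hN hi).symm).symm

lemma dimN_pos (hN : 2 ≤ N) {i : ℕ} (hi : 0 < i) : 0 < dimN N i := by
  rw [← finrank_harmPoly hN hi]
  refine Nat.pos_of_ne_zero fun h => ?_
  have := finrank_harmPoly_mul hN hi
  rw [h, zero_mul] at this
  have h1 : 0 < (N + 2 * i) * (N + i - 2).factorial := by positivity
  omega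

end HarmonicDecomposition

section Projection

open MvPolynomial

variable {N : ℕ}

lemma polyFun_smul (c : ℝ) (p : MvPolynomial (Fin N) ℝ) (x : Eu N) :
    polyFun (c • p) x = c * polyFun p x := by
  simp [polyFun, smul_eval]

lemma polyFun_sum {ι : Type*} (s : Finset ι) (p : ι → MvPolynomial (Fin N) ℝ) (x : Eu N) :
    polyFun (∑ i ∈ s, p i) x = ∑ i ∈ s, polyFun (p i) x := by
  simp [polyFun]

/-- Integration on the sphere against a continuous function, as a functional on polynomials. -/
noncomputable def spherePairing {g : Sph N → ℝ} (hg : Continuous g) :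
    MvPolynomial (Fin N) ℝ →ₗ[ℝ] ℝ where
  toFun p := ∫ θ, g θ * polyFun p θ ∂sphMeas N
  map_add' p q := integral_mul_polyFun_add hg p q
  map_smul' c p := by
    simp only [polyFun_smul, mul_left_comm (g _), integral_const_mul, RingHom.id_apply,
      smul_eq_mul]

/-- Every continuous function on the sphere has an orthogonal projection onto the spherical
harmonics of degree `j`. -/
lemma exists_harmPoly_projection (hN : 1 ≤ N) (j : ℕ) {g : Sph N → ℝ} (hg : Continuous g) :
    ∃ Y ∈ harmPoly N j, ∀ q ∈ harmPoly N j,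
      ∫ θ : Sph N, polyFun Y θ * polyFun q θ ∂sphMeas N =
        ∫ θ, g θ * polyFun q θ ∂sphMeas N := by
  set B : harmPoly N j →ₗ[ℝ] Module.Dual ℝ (harmPoly N j) :=
    LinearMap.mk₂ ℝ (fun Y q => spherePairing (continuous_polyFun_sphere Y.1) q.1)
      (fun Y Z q => by
        have := (spherePairing (continuous_polyFun_sphere q.1)).map_add Y.1 Z.1
        simp only [spherePairing, LinearMap.coe_mk, AddHom.coe_mk, mul_comm] at this ⊢
        exact this)
      (fun c Y q => by
        have := (spherePairing (continuous_polyFun_sphere q.1)).map_smul c Y.1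
        simp only [spherePairing, LinearMap.coe_mk, AddHom.coe_mk, mul_comm] at this ⊢
        exact this)
      (fun Y p q => by simp) (fun c Y q => by simp) with hB
  have hinj : Function.Injective B := by
    rw [injective_iff_map_eq_zero]
    intro Y hY
    have h : ∫ θ : Sph N, polyFun Y.1 θ ^ 2 ∂sphMeas N = 0 := by
      simp only [pow_two]
      exact LinearMap.congr_fun hY Y
    exact Subtype.ext (eq_zero_of_polyFun_sphere Y.2.1 hN
      (eq_zero_of_integral_sq_sphere (continuous_polyFun_sphere _) h))
  obtain ⟨Y, hY⟩ := (LinearMap.injective_iff_surjective_of_finrank_eq_finrank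
    (Subspace.dual_finrank_eq (K := ℝ) (V := harmPoly N j)).symm).1 hinj
    ((spherePairing hg).domRestrict _)
  exact ⟨Y, Y.2, fun q hq => LinearMap.congr_fun hY ⟨q, hq⟩⟩

lemma exists_eq_harmPoly (hN : 2 ≤ N) {j : ℕ} {g : Sph N → ℝ} (hg : Continuous g)
    (h : ∀ l ≠ j, ∀ p ∈ harmPoly N l, ∫ θ, g θ * polyFun p θ ∂sphMeas N = 0) :
    ∃ Y ∈ harmPoly N j, ∀ θ : Sph N, g θ = polyFun Y θ := by
  obtain ⟨Y, hYmem, hY⟩ := exists_harmPoly_projection (by omega) j hg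
  refine ⟨Y, hYmem, fun θ => sub_eq_zero.1 (eq_zero_of_orthogonal_harmPoly hN
    (g := fun θ => g θ - polyFun Y θ) (hg.sub (continuous_polyFun_sphere Y)) (fun l p hp => ?_) θ)⟩
  simp only [sub_mul]
  rw [integral_sub (integrable_mul_polyFun hg p)
    (integrable_mul_polyFun (continuous_polyFun_sphere Y) p)]
  by_cases hl : l = j
  · subst hl
    rw [hY p hp, sub_self]
  · rw [h l hl p hp, (solidHarmonic_of_mem_harmPoly hYmem).orthogonal
      (solidHarmonic_of_mem_harmPoly hp) hN (Ne.symm hl), sub_zero]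

end Projection

section Classification

variable {N : ℕ} {α M : ℝ} {A χ : ℝ → ℝ} {w : Eu N → ℝ}

lemma angular_eq_kk_iff (hN : 2 ≤ N) (hα : 0 < α) (j : ℕ) :
    4 * ((j:ℝ) * (j + N - 2)) / (2 + α) ^ 2 = kk N α ↔ α = 2 * ((j:ℝ) - 1) := by
  have h2 : 2 + α ≠ 0 := by positivity
  have hN' : (2:ℝ) ≤ N := by exact_mod_cast hN
  have hj : (0:ℝ) ≤ j := j.cast_nonneg
  rw [kk, div_eq_div_iff (pow_ne_zero 2 h2) h2]
  constructor
  · intro h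
    have h3 : (2 + α) * ((α - 2 * (j - 1)) * (2 * (N + j - 1) + α)) = 0 := by
      linear_combination -h
    have h4 : 2 * ((N:ℝ) + j - 1) + α ≠ 0 := by
      have : (0:ℝ) < 2 * ((N:ℝ) + j - 1) + α := by linarith
      exact this.ne'
    have := (mul_eq_zero.1 ((mul_eq_zero.1 h3).resolve_left h2)).resolve_right h4
    linarith
  · rintro rfl
    ring

lemma LinSolution.continuous_sphere (hw : ContDiffOn ℝ 2 w {x | x ≠ 0}) {r : ℝ} (hr : 0 < r) :
    Continuous fun θ : Sph N => w (r • (θ : Eu N)) :=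
  hw.continuousOn.comp_continuous (by fun_prop) fun θ => smul_sphere_ne_zero hr θ

lemma LinSolution.mode_zero (hN : 1 ≤ N) (hα : 0 < α) (hnondeg : RadNondeg (kk N α) A)
    (hw : LinSolution N α (fun x => A (emden α ‖x‖)) w) {P : Eu N → ℝ} (hP : SolidHarmonic 0 P)
    {r : ℝ} (hr : 0 < r) : mode w P r = 0 := by
  obtain ⟨h2, hE, heq⟩ := hw.singSol hN hα hP
  have h := hnondeg _ h2 hE (fun t ht => by simpa using heq t ht) _ (emden_pos hα hr)
  simpa [emdenInv_emden hα hr] using h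

lemma LinSolution.mode_proportional (hN : 3 ≤ N) (hα : 0 < α) (hA : ContinuousOn A (Ioi 0))
    (hM : ∀ t > 0, |A t| ≤ M) (hmorse : MorseIndexOne (kk N α) A)
    (hnondeg : RadNondeg (kk N α) A) (hχ : SingSol (kk N α) A (kk N α) χ)
    (hχ0 : ∃ t > 0, χ t ≠ 0) (hw : LinSolution N α (fun x => A (emden α ‖x‖)) w) {j : ℕ}
    {P : Eu N → ℝ} (hP : SolidHarmonic j P) :
    ∃ c : ℝ, (∀ r > 0, mode w P r = c * χ (emden α r)) ∧ (α ≠ 2 * ((j:ℝ) - 1) → c = 0) := by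
  rcases Nat.eq_zero_or_pos j with rfl | hj
  · exact ⟨0, fun r hr => by rw [hw.mode_zero (by omega) hα hnondeg hP hr, zero_mul], fun _ => rfl⟩
  · have hk := one_lt_kk hN hα
    have hj' : (1:ℝ) ≤ j := by exact_mod_cast hj
    have hN' : (3:ℝ) ≤ N := by exact_mod_cast hN
    have hμ : 0 < 4 * ((j:ℝ) * (j + N - 2)) / (2 + α) ^ 2 := by
      have : 0 < (j:ℝ) + N - 2 := by linarith
      positivity
    obtain ⟨c, hc, hc0⟩ := hmorse.proportional hk hA hM hμ (by linarith)
      (hw.singSol (by omega) hα hP) hχ hχ0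
    refine ⟨c, fun r hr => ?_, fun h => hc0 fun h' => h ((angular_eq_kk_iff (by omega) hα j).1 h')⟩
    rw [← hc _ (emden_pos hα hr), emdenInv_emden hα hr]

lemma LinSolution.eq_zero_of_ne (hN : 3 ≤ N) (hα : 0 < α) (hA : ContinuousOn A (Ioi 0))
    (hM : ∀ t > 0, |A t| ≤ M) (hmorse : MorseIndexOne (kk N α) A)
    (hnondeg : RadNondeg (kk N α) A) (hχ : SingSol (kk N α) A (kk N α) χ)
    (hχ0 : ∃ t > 0, χ t ≠ 0) (hw : LinSolution N α (fun x => A (emden α ‖x‖)) w)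
    (hne : ∀ j : ℕ, α ≠ 2 * ((j:ℝ) - 1)) {x : Eu N} (hx : x ≠ 0) : w x = 0 := by
  have hr : 0 < ‖x‖ := norm_pos_iff.2 hx
  have h := eq_zero_of_orthogonal_harmPoly (by omega) (LinSolution.continuous_sphere hw.1 hr)
    (fun l p hp => ?_) ⟨‖x‖⁻¹ • x, by simp [norm_smul, hr.ne']⟩
  · simpa [smul_inv_smul₀ hr.ne'] using h
  · obtain ⟨c, hc, hc0⟩ := hw.mode_proportional hN hα hA hM hmorse hnondeg hχ hχ0
      (solidHarmonic_of_mem_harmPoly hp)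
    have := hc _ hr
    rwa [hc0 (hne l), zero_mul] at this

lemma LinSolution.eq_sepFun (hN : 3 ≤ N) (hα : 0 < α) (hA : ContinuousOn A (Ioi 0))
    (hM : ∀ t > 0, |A t| ≤ M) (hmorse : MorseIndexOne (kk N α) A)
    (hnondeg : RadNondeg (kk N α) A) (hχ : SingSol (kk N α) A (kk N α) χ)
    (hχ0 : ∃ t > 0, χ t ≠ 0) (hw : LinSolution N α (fun x => A (emden α ‖x‖)) w) {j : ℕ}
    (hj : α = 2 * ((j:ℝ) - 1)) :
    ∃ Y ∈ harmPoly N j, ∀ x : Eu N, x ≠ 0 →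
      w x = sepFun j (fun r => χ (emden α r)) (polyFun Y) x := by
  have hmode : ∀ l, ∀ p ∈ harmPoly N l, _ := fun l p hp =>
    hw.mode_proportional hN hα hA hM hmorse hnondeg hχ hχ0 (solidHarmonic_of_mem_harmPoly hp)
  obtain ⟨t₀, ht₀, hχt₀⟩ := hχ0
  set f : Sph N → ℝ := fun θ => (χ t₀)⁻¹ * w (emdenInv α t₀ • (θ : Eu N)) with hf_def
  have hr₀ := emdenInv_pos hα ht₀
  have hf : Continuous f := continuous_const.mul (LinSolution.continuous_sphere hw.1 hr₀)
  have hfint : ∀ p, ∫ θ, f θ * polyFun p θ ∂sphMeas N =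
      (χ t₀)⁻¹ * mode w (polyFun p) (emdenInv α t₀) := fun p => by
    simp only [hf_def, mul_assoc, integral_const_mul, mode]
  have hwf : ∀ r > 0, ∀ θ : Sph N, w (r • (θ : Eu N)) = χ (emden α r) * f θ := fun r hr θ => by
    have hwr := LinSolution.continuous_sphere hw.1 hr
    refine sub_eq_zero.1 (eq_zero_of_orthogonal_harmPoly (by omega)
      (g := fun θ => w (r • (θ : Eu N)) - χ (emden α r) * f θ)
      (hwr.sub (continuous_const.mul hf)) (fun l p hp => ?_) θ)
    obtain ⟨c, hc, -⟩ := hmode l p hp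
    simp only [sub_mul, mul_assoc]
    rw [integral_sub (integrable_mul_polyFun hwr p) ((integrable_mul_polyFun hf p).const_mul _),
      integral_const_mul, hfint, hc _ hr₀, emden_emdenInv hα ht₀]
    change mode w (polyFun p) r - _ = 0
    rw [hc r hr]
    field_simp
    ring
  obtain ⟨Y, hY, hfY⟩ := exists_eq_harmPoly (by omega) hf (j := j) fun l hl p hp => by
    obtain ⟨c, hc, hc0⟩ := hmode l p hp
    rw [hfint, hc _ hr₀, hc0 fun h => hl ?_, zero_mul, mul_zero]
    rw [hj] at h
    exact_mod_cast (by linarith : (l:ℝ) = j)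
  refine ⟨Y, hY, fun x hx => ?_⟩
  have hr : 0 < ‖x‖ := norm_pos_iff.2 hx
  have h1 := hwf ‖x‖ hr ⟨‖x‖⁻¹ • x, by simp [norm_smul, hr.ne']⟩
  rw [hfY] at h1
  simp only [smul_inv_smul₀ hr.ne', (solidHarmonic_of_mem_harmPoly hY).2.1] at h1
  rw [h1, sepFun, inv_pow]
  ring

lemma eq_zero_of_sepFun_eq_zero (hN : 1 ≤ N) (hα : 0 < α) (hχ0 : ∃ t > 0, χ t ≠ 0) {j : ℕ}
    {p : MvPolynomial (Fin N) ℝ} (hp : p.IsHomogeneous j)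
    (h : ∀ x : Eu N, x ≠ 0 → sepFun j (fun r => χ (emden α r)) (polyFun p) x = 0) : p = 0 := by
  obtain ⟨t, ht, hχt⟩ := hχ0
  have hr := emdenInv_pos hα ht
  refine eq_zero_of_polyFun_sphere hp hN fun θ => ?_
  have h1 := h _ (smul_sphere_ne_zero hr θ)
  rw [sepFun, norm_smul, norm_eq_of_mem_sphere, mul_one, Real.norm_of_nonneg hr.le,
    polyFun_smul_of_isHomogeneous hp, emden_emdenInv hα ht] at h1
  simpa [hχt, hr.ne'] using h1

end Classification

theorem stmt4 (N : ℕ) (hN : 3 ≤ N) (α : ℝ) (hα : 0 < α)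
    (F : ℝ → ℝ) (hF : ContDiff ℝ 1 F)
    (V : ℝ → ℝ) (hV : ContDiffOn ℝ 2 V (Ioi 0)) (hVpos : ∀ t > (0:ℝ), 0 < V t)
    (hode : ∀ t > (0:ℝ), -(deriv (deriv V) t) - kk N α / t * deriv V t = F (V t))
    (hV'0 : Tendsto (deriv V) (𝓝[>] 0) (𝓝 0)) (hVinf : Tendsto V atTop (𝓝 0))
    (hmorse : MorseIndexOne (kk N α) (fun t => deriv F (V t)))
    (hV'E : memE (kk N α) (deriv V))
    (hnondeg : RadNondeg (kk N α) (fun t => deriv F (V t))) :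
    ((∃ w : EuclideanSpace ℝ (Fin N) → ℝ,
        LinSolution N α (fun x => deriv F (V (2 / (2 + α) * ‖x‖ ^ ((2 + α) / 2)))) w ∧
        ∃ x : EuclideanSpace ℝ (Fin N), x ≠ 0 ∧ w x ≠ 0) ↔
      ∃ i : ℕ, 0 < i ∧ α = 2 * i) ∧
    ∀ i : ℕ, 0 < i → α = 2 * i →
      ∃ b : Fin (dimN N i) → EuclideanSpace ℝ (Fin N) → ℝ,
        (∀ j, LinSolution N α
          (fun x => deriv F (V (2 / (2 + α) * ‖x‖ ^ ((2 + α) / 2)))) (b j)) ∧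
        (∀ c : Fin (dimN N i) → ℝ,
          (∀ x : EuclideanSpace ℝ (Fin N), x ≠ 0 → ∑ j, c j * b j x = 0) → c = 0) ∧
        ∀ w : EuclideanSpace ℝ (Fin N) → ℝ,
          LinSolution N α (fun x => deriv F (V (2 / (2 + α) * ‖x‖ ^ ((2 + α) / 2)))) w →
          ∃ c : Fin (dimN N i) → ℝ, ∀ x : EuclideanSpace ℝ (Fin N), x ≠ 0 →
            w x = ∑ j, c j * b j x := by
  have hk := one_lt_kk hN hα
  have hN2 : 2 ≤ N := by omega
  have hVd : DifferentiableOn ℝ V (Ioi 0) := hV.differentiableOn (by norm_num)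
  obtain ⟨C, hC⟩ := exists_bound_of_tendsto hVd hV'0 hVinf
  obtain ⟨M, hM⟩ := exists_bound_deriv_comp hF hC
  have hA : ContinuousOn (fun t => deriv F (V t)) (Ioi 0) :=
    (hF.continuous_deriv le_rfl).comp_continuousOn hV.continuousOn
  have hχ := singSol_deriv hF hV hode hV'E
  have hχ0 := exists_deriv_ne_zero_of_pos hVd hVpos hVinf
  have hpot : (fun x : EuclideanSpace ℝ (Fin N) =>
      deriv F (V (2 / (2 + α) * ‖x‖ ^ ((2 + α) / 2)))) =
      fun x => (fun t => deriv F (V t)) (emden α ‖x‖) := rfl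
  rw [hpot]
  have hindex : ∀ i : ℕ, α = 2 * i → α = 2 * (((i + 1 : ℕ) : ℝ) - 1) := fun i h => by
    push_cast
    linarith
  have hsol : ∀ i : ℕ, α = 2 * i → ∀ p ∈ harmPoly N (i + 1),
      LinSolution N α (fun x => (fun t => deriv F (V t)) (emden α ‖x‖))
        (sepFun (i + 1) (fun r => deriv V (emden α r)) (polyFun p)) := fun i hi p hp => by
    refine SingSol.linSolution (A := fun t => deriv F (V t)) (χ := deriv V) hN hα (by omega) ?_ (solidHarmonic_of_mem_harmPoly hp)
    rwa [(angular_eq_kk_iff hN2 hα (i + 1)).2 (hindex i hi)]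
  have hbasis : ∀ i : ℕ, 0 < i → α = 2 * i →
      ∃ b : Fin (dimN N i) → EuclideanSpace ℝ (Fin N) → ℝ,
        (∀ j, LinSolution N α (fun x => (fun t => deriv F (V t)) (emden α ‖x‖)) (b j)) ∧
        (∀ c : Fin (dimN N i) → ℝ,
          (∀ x : EuclideanSpace ℝ (Fin N), x ≠ 0 → ∑ j, c j * b j x = 0) → c = 0) ∧
        ∀ w : EuclideanSpace ℝ (Fin N) → ℝ,
          LinSolution N α (fun x => (fun t => deriv F (V t)) (emden α ‖x‖)) w →
          ∃ c : Fin (dimN N i) → ℝ, ∀ x : EuclideanSpace ℝ (Fin N), x ≠ 0 →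
            w x = ∑ j, c j * b j x := by
    intro i hi hαi
    set B := Module.finBasisOfFinrankEq ℝ (harmPoly N (i + 1)) (finrank_harmPoly hN2 hi)
    have hsum : ∀ (c : Fin (dimN N i) → ℝ) (x : Eu N),
        ∑ j, c j * sepFun (i + 1) (fun r => deriv V (emden α r)) (polyFun (B j).1) x =
          sepFun (i + 1) (fun r => deriv V (emden α r)) (polyFun (∑ j, c j • B j).1) x :=
      fun c x => by
        simp only [sepFun, AddSubmonoidClass.coe_finsetSum, SetLike.val_smul, polyFun_sum,
          polyFun_smul, Finset.mul_sum]
        exact Finset.sum_congr rfl fun j _ => by ring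
    refine ⟨fun j => sepFun (i + 1) (fun r => deriv V (emden α r)) (polyFun (B j).1),
      fun j => hsol i hαi _ (B j).2, fun c hc => ?_, fun w hw => ?_⟩
    · simp only [hsum] at hc
      have h := eq_zero_of_sepFun_eq_zero (by omega) hα hχ0 (∑ j, c j • B j).2.1 hc
      exact funext (Fintype.linearIndependent_iff.1 B.linearIndependent c (Subtype.ext h))
    · obtain ⟨Y, hY, hwY⟩ := hw.eq_sepFun hN hα hA hM hmorse hnondeg hχ hχ0 (hindex i hαi)
      refine ⟨B.repr ⟨Y, hY⟩, fun x hx => ?_⟩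
      rw [hsum, B.sum_repr, hwY x hx]
  refine ⟨⟨?_, ?_⟩, hbasis⟩
  · rintro ⟨w, hw, x, hx, hwx⟩
    by_contra! hne
    refine hwx (hw.eq_zero_of_ne hN hα hA hM hmorse hnondeg hχ hχ0 (fun j hj => ?_) hx)
    have h1 : (1:ℝ) < j := by linarith
    have h2 : 1 < j := by exact_mod_cast h1
    refine hne (j - 1) (by omega) ?_
    rw [Nat.cast_sub h2.le, hj, Nat.cast_one]
  · rintro ⟨i, hi, hαi⟩
    obtain ⟨b, hb, hli, -⟩ := hbasis i hi hαi
    by_contra! hcon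
    have h := hli (Function.const _ 1) fun x hx => by simp [hcon (b _) (hb _) x hx]
    exact one_ne_zero (congrFun h ⟨0, dimN_pos hN2 hi⟩)
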